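/- In the 2-block stochastic block model with p ≥ Ω(log²n / n) and γ = (p−q)/(p+q) with p > q, with probability 1 − n^{−Ω(1)} both of the following hold: ‖Ã − γ·ssᵀ‖ ≤ O(1/√(np)) and ‖Â − γ·ssᵀ‖ ≤ O(√(log n/(np))), where s ∈ ℝ^n has s(i) = 1/√n for i ∈ S and s(i) = −1/√n for i ∈ T. -/

import Mathlib

open MeasureTheory ProbabilityTheory Matrix

/-- Bernoulli measure on `Bool` with success probability `p`. -/
noncomputable def bern (p : ℝ) : Measure Bool :=
  ENNReal.ofReal (1 - p) • Measure.dirac false + ENNReal.ofReal p • Measure.dirac true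

/-- Edge randomness of the 2-block stochastic block model on `n` vertices:
independent Bernoulli variables, with probability `p` for pairs inside a class and `q`
across classes.  Class `S` consists of the first `n/2` vertices; only the upper triangle
is used to build the (symmetric) adjacency matrix. -/
noncomputable def sbm (n : ℕ) (p q : ℝ) : Measure (Fin n → Fin n → Bool) :=
  Measure.pi fun i => Measure.pi fun j =>
    bern (if ((i : ℕ) < n / 2 ↔ (j : ℕ) < n / 2) then p else q)

/-- The (symmetric, hollow) adjacency matrix built from the edge indicators. -/
noncomputable def adjM {n : ℕ} (ω : Fin n → Fin n → Bool) : Matrix (Fin n) (Fin n) ℝ :=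
  Matrix.of fun i j =>
    if i = j then 0 else if (if i ≤ j then ω i j else ω j i) then 1 else 0

/-- Empirical average degree `d = 2|E|/n`. -/
noncomputable def avgDeg {n : ℕ} (ω : Fin n → Fin n → Bool) : ℝ :=
  (∑ i, ∑ j, adjM ω i j) / n

/-- Corrected graph convolution matrix `Ã = (1/d)A - (1/n)𝟙𝟙ᵀ`. -/
noncomputable def tildeA {n : ℕ} (ω : Fin n → Fin n → Bool) : Matrix (Fin n) (Fin n) ℝ :=
  (avgDeg ω)⁻¹ • adjM ω - (n : ℝ)⁻¹ • Matrix.of (fun _ _ => (1 : ℝ))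

/-- The unit signal vector `s`, with entries `1/√n` on `S` and `-1/√n` on `T`. -/
noncomputable def sig (n : ℕ) : Fin n → ℝ :=
  fun i => if (i : ℕ) < n / 2 then (Real.sqrt n)⁻¹ else -(Real.sqrt n)⁻¹

/-- Spectral norm (ℓ²→ℓ² operator norm) of a real square matrix. -/
noncomputable def specNorm {n : ℕ} (M : Matrix (Fin n) (Fin n) ℝ) : ℝ :=
  ‖Matrix.toEuclideanCLM (𝕜 := ℝ) M‖

/-- Degree of vertex `v`. -/
noncomputable def degv {n : ℕ} (ω : Fin n → Fin n → Bool) (v : Fin n) : ℝ := ∑ j, adjM ω v j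

/-- Corrected normalized convolution matrix
`Â = D^{-1/2} A D^{-1/2} - (1/Σ_v d_v) · D^{1/2} 𝟙𝟙ᵀ D^{1/2}`. -/
noncomputable def hatA {n : ℕ} (ω : Fin n → Fin n → Bool) : Matrix (Fin n) (Fin n) ℝ :=
  (Matrix.of fun i j => adjM ω i j / (Real.sqrt (degv ω i) * Real.sqrt (degv ω j)))
    - (Matrix.of fun i j => Real.sqrt (degv ω i) * Real.sqrt (degv ω j) / ∑ v, degv ω v)

/-- Independent Bernoulli variables with success probabilities `P i j`. -/
noncomputable def bernProd {n : ℕ} (P : Fin n → Fin n → ℝ) : Measure (Fin n → Fin n → Bool) :=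
  Measure.pi fun i => Measure.pi fun j => bern (P i j)

/-- The symmetric hollow matrix of centered edge indicators, read off the upper triangle. -/
noncomputable def centeredAdj {n : ℕ} (P : Fin n → Fin n → ℝ) (ω : Fin n → Fin n → Bool) :
    Matrix (Fin n) (Fin n) ℝ :=
  Matrix.of fun i j =>
    if i = j then 0 else
      (if ω (min i j) (max i j) then 1 else 0) - P (min i j) (max i j)

lemma isProbabilityMeasure_bern {p : ℝ} (h0 : 0 ≤ p) (h1 : p ≤ 1) :
    IsProbabilityMeasure (bern p) := by
  constructor
  simp only [bern, Measure.coe_add, Measure.coe_smul, Pi.add_apply, Pi.smul_apply, measure_univ,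
    smul_eq_mul, mul_one]
  rw [← ENNReal.ofReal_add (by linarith) h0]
  simp

lemma integral_bern {p : ℝ} (h0 : 0 ≤ p) (h1 : p ≤ 1) (g : Bool → ℝ) :
    ∫ b, g b ∂(bern p) = (1 - p) * g false + p * g true := by
  rw [bern, integral_add_measure, integral_smul_measure, integral_smul_measure, integral_dirac,
    integral_dirac, ENNReal.toReal_ofReal h0, ENNReal.toReal_ofReal (by linarith)]
  · simp
  · exact (integrable_dirac (by simp)).smul_measure ENNReal.ofReal_ne_top
  · exact (integrable_dirac (by simp)).smul_measure ENNReal.ofReal_ne_top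

lemma isProbabilityMeasure_bernProd {n : ℕ} {P : Fin n → Fin n → ℝ}
    (h0 : ∀ i j, 0 ≤ P i j) (h1 : ∀ i j, P i j ≤ 1) : IsProbabilityMeasure (bernProd P) := by
  have : ∀ i j, IsProbabilityMeasure (bern (P i j)) :=
    fun i j => isProbabilityMeasure_bern (h0 i j) (h1 i j)
  unfold bernProd
  infer_instance

lemma integral_bernProd_prod {n : ℕ} {P : Fin n → Fin n → ℝ}
    (h0 : ∀ i j, 0 ≤ P i j) (h1 : ∀ i j, P i j ≤ 1) (g : Fin n → Fin n → Bool → ℝ) :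
    ∫ ω, ∏ i, ∏ j, g i j (ω i j) ∂(bernProd P) =
      ∏ i, ∏ j, ((1 - P i j) * g i j false + P i j * g i j true) := by
  have : ∀ i j, IsProbabilityMeasure (bern (P i j)) :=
    fun i j => isProbabilityMeasure_bern (h0 i j) (h1 i j)
  unfold bernProd
  rw [integral_fintype_prod_eq_prod (f := fun i (x : Fin n → Bool) => ∏ j, g i j (x j))]
  refine Finset.prod_congr rfl fun i _ => ?_
  rw [integral_fintype_prod_eq_prod (f := fun j (x : Bool) => g i j x)]
  exact Finset.prod_congr rfl fun j _ => integral_bern (h0 i j) (h1 i j) _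

lemma integrable_bernProd {n : ℕ} {P : Fin n → Fin n → ℝ}
    (h0 : ∀ i j, 0 ≤ P i j) (h1 : ∀ i j, P i j ≤ 1) (f : (Fin n → Fin n → Bool) → ℝ) :
    Integrable f (bernProd P) := by
  have := isProbabilityMeasure_bernProd h0 h1
  exact Integrable.of_finite

lemma Matrix.pow_apply_eq_sum_walks {n : ℕ} (M : Matrix (Fin n) (Fin n) ℝ) (L : ℕ) (i j : Fin n) :
    (M ^ L) i j = ∑ w : Fin (L + 1) → Fin n, if w 0 = i ∧ w (Fin.last L) = j then
      ∏ t : Fin L, M (w t.castSucc) (w t.succ) else 0 := by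
  induction L generalizing i with
  | zero =>
    rw [← (Equiv.funUnique (Fin 1) (Fin n)).symm.sum_comp]
    by_cases h : i = j
    · subst h
      simp
    · simp only [pow_zero, Matrix.one_apply, h, if_false]
      symm
      apply Finset.sum_eq_zero
      intro a _
      rw [if_neg]
      simp only [Equiv.funUnique_symm_apply, uniqueElim_const]
      rintro ⟨rfl, rfl⟩
      exact h rfl
  | succ L ih =>
    rw [pow_succ', Matrix.mul_apply, ← (Fin.consEquiv (fun _ => Fin n)).sum_comp,
      Fintype.sum_prod_type]
    simp only [Fin.consEquiv_apply, Fin.cons_zero, ← Fin.succ_last, Fin.cons_succ,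
      Fin.prod_univ_succ, Fin.castSucc_zero, ← Fin.succ_castSucc]
    symm
    rw [Finset.sum_eq_single i]
    · simp only [ih, Finset.mul_sum, true_and]
      rw [Finset.sum_comm]
      refine Finset.sum_congr rfl fun w _ => ?_
      rw [Finset.sum_eq_single (w 0)]
      · by_cases h : w (Fin.last L) = j <;> simp [h]
      · intro a _ ha
        simp [ha.symm]
      · simp
    · intro a _ ha
      simp [ha]
    · simp

/-- Sum of `∏ M` over closed walks. -/
lemma Matrix.trace_pow_eq_sum_walks {n : ℕ} (M : Matrix (Fin n) (Fin n) ℝ) (L : ℕ) :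
    (M ^ L).trace = ∑ w : Fin (L + 1) → Fin n, if w 0 = w (Fin.last L) then
      ∏ t : Fin L, M (w t.castSucc) (w t.succ) else 0 := by
  simp only [Matrix.trace, Matrix.diag_apply, Matrix.pow_apply_eq_sum_walks]
  rw [Finset.sum_comm]
  refine Finset.sum_congr rfl fun w _ => ?_
  rw [Finset.sum_eq_single (w 0)]
  · simp [eq_comm]
  · intro a _ ha
    simp [ha.symm]
  · simp

/-- The edge used by step `t` of a walk, with its smaller endpoint first. -/
def walkEdge {n L : ℕ} (w : Fin (L + 1) → Fin n) (t : Fin L) : Fin n × Fin n :=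
  (min (w t.castSucc) (w t.succ), max (w t.castSucc) (w t.succ))

/-- The number of steps of a walk that use the edge `e`. -/
def walkMult {n L : ℕ} (w : Fin (L + 1) → Fin n) (e : Fin n × Fin n) : ℕ :=
  (Finset.univ.filter fun t => walkEdge w t = e).card

/-- The `k`-th central moment of a Bernoulli variable. -/
noncomputable def bernMoment (p : ℝ) (k : ℕ) : ℝ := (1 - p) * (-p) ^ k + p * (1 - p) ^ k

lemma integral_walk {n L : ℕ} {P : Fin n → Fin n → ℝ}
    (h0 : ∀ i j, 0 ≤ P i j) (h1 : ∀ i j, P i j ≤ 1) (w : Fin (L + 1) → Fin n)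
    (hw : ∀ t : Fin L, w t.castSucc ≠ w t.succ) :
    ∫ ω, ∏ t : Fin L, centeredAdj P ω (w t.castSucc) (w t.succ) ∂(bernProd P) =
      ∏ e : Fin n × Fin n, bernMoment (P e.1 e.2) (walkMult w e) := by
  have h (ω : Fin n → Fin n → Bool) :
      ∏ t : Fin L, centeredAdj P ω (w t.castSucc) (w t.succ) =
      ∏ i, ∏ j, ((if ω i j then 1 else 0) - P i j) ^ walkMult w (i, j) := by
    rw [← Fintype.prod_prod_type'
      (f := fun i j => ((if ω i j then 1 else 0) - P i j) ^ walkMult w (i, j)),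
      ← Finset.prod_fiberwise (s := Finset.univ) (g := walkEdge w)]
    refine Finset.prod_congr rfl fun e _ => ?_
    rw [walkMult, ← Finset.prod_const]
    refine Finset.prod_congr rfl fun t ht => ?_
    have he : walkEdge w t = e := (Finset.mem_filter.1 ht).2
    simp [centeredAdj, hw t, ← he, walkEdge]
  simp only [h]
  rw [integral_bernProd_prod h0 h1
    (g := fun i j b => ((if b then 1 else 0) - P i j) ^ walkMult w (i, j)), Fintype.prod_prod_type]
  simp [bernMoment]

lemma integral_walk_of_loop {n L : ℕ} (P : Fin n → Fin n → ℝ) (w : Fin (L + 1) → Fin n)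
    {t : Fin L} (ht : w t.castSucc = w t.succ) :
    ∫ ω, ∏ t : Fin L, centeredAdj P ω (w t.castSucc) (w t.succ) ∂(bernProd P) = 0 := by
  have h (ω : Fin n → Fin n → Bool) :
      ∏ t : Fin L, centeredAdj P ω (w t.castSucc) (w t.succ) = 0 :=
    Finset.prod_eq_zero (Finset.mem_univ t) (by simp [centeredAdj, ht])
  simp [h]

lemma bernMoment_zero (p : ℝ) : bernMoment p 0 = 1 := by simp [bernMoment]

lemma bernMoment_one (p : ℝ) : bernMoment p 1 = 0 := by simp [bernMoment]; ring

lemma abs_bernMoment_le {p : ℝ} (h0 : 0 ≤ p) (h1 : p ≤ 1) {k : ℕ} (hk : 2 ≤ k) :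
    |bernMoment p k| ≤ p := by
  have key (a : ℝ) (ha : 0 ≤ a) (ha' : a ≤ 1) : a ^ k ≤ a * a := by
    rw [← sq]
    exact pow_le_pow_of_le_one ha ha' hk
  calc |bernMoment p k| ≤ |(1 - p) * (-p) ^ k| + |p * (1 - p) ^ k| := abs_add_le _ _
    _ = (1 - p) * p ^ k + p * (1 - p) ^ k := by
        rw [abs_mul, abs_mul, abs_pow, abs_pow, abs_neg, abs_of_nonneg h0,
          abs_of_nonneg (by linarith : 0 ≤ 1 - p)]
    _ ≤ (1 - p) * (p * p) + p * ((1 - p) * (1 - p)) := by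
        have : 0 ≤ 1 - p := by linarith
        gcongr
        · exact key p h0 h1
        · exact key (1 - p) this (by linarith)
    _ ≤ p := by nlinarith

lemma one_le_bernMoment_third {k : ℕ} (hk : 2 ≤ k) : 1 ≤ 3 ^ k * bernMoment (1 / 3) k := by
  have : (3 : ℝ) ^ k * bernMoment (1 / 3) k = (2 * (-1) ^ k + 2 ^ k) / 3 := by
    have e : ∀ a : ℝ, (3 : ℝ) ^ k * (a / 3) ^ k = a ^ k := fun a => by
      rw [← mul_pow]; congr 1; ring
    have e1 := e (-1)
    have e2 := e 2
    rw [bernMoment, show -(1 / 3 : ℝ) = -1 / 3 by ring, show (1 - 1 / 3 : ℝ) = 2 / 3 by norm_num,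
      mul_add, mul_left_comm, e1, mul_left_comm, e2]
    ring
  rw [this]
  rcases Nat.even_or_odd k with h | h
  · rw [h.neg_one_pow]
    have : (1 : ℝ) ≤ 2 ^ k := one_le_pow₀ (by norm_num)
    linarith
  · rw [h.neg_one_pow]
    have : 3 ≤ k := by
      rcases h with ⟨m, rfl⟩
      omega
    have : (2 : ℝ) ^ 3 ≤ 2 ^ k := pow_le_pow_right₀ (by norm_num) this
    linarith

/-- A closed walk without loops that uses each of its edges at least twice. -/
def IsDoubledWalk {α : Type*} {L : ℕ} (w : Fin (L + 1) → α) : Prop :=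
  w 0 = w (Fin.last L) ∧ (∀ t : Fin L, w t.castSucc ≠ w t.succ) ∧
    ∀ t : Fin L, ∃ t' ≠ t, s(w t'.castSucc, w t'.succ) = s(w t.castSucc, w t.succ)

lemma walkEdge_eq_iff {n L : ℕ} (w : Fin (L + 1) → Fin n) (t t' : Fin L) :
    walkEdge w t' = walkEdge w t ↔
      s(w t'.castSucc, w t'.succ) = s(w t.castSucc, w t.succ) := by
  rw [walkEdge, walkEdge, Prod.mk.injEq, Sym2.eq_iff]
  constructor
  · rintro ⟨h1, h2⟩
    rcases le_total (w t'.castSucc) (w t'.succ) with h | h <;>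
      rcases le_total (w t.castSucc) (w t.succ) with h' | h' <;> simp_all
  · rintro (⟨h1, h2⟩ | ⟨h1, h2⟩) <;> rw [h1, h2]
    · simp
    · exact ⟨min_comm _ _, max_comm _ _⟩

lemma walkMult_eq_zero_iff {n L : ℕ} (w : Fin (L + 1) → Fin n) (e : Fin n × Fin n) :
    walkMult w e = 0 ↔ e ∉ Finset.univ.image (walkEdge w) := by
  simp [walkMult, Finset.filter_eq_empty_iff]

lemma IsDoubledWalk.two_le_walkMult {n L : ℕ} {w : Fin (L + 1) → Fin n} (hw : IsDoubledWalk w)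
    {e : Fin n × Fin n} (he : e ∈ Finset.univ.image (walkEdge w)) : 2 ≤ walkMult w e := by
  obtain ⟨t, -, rfl⟩ := Finset.mem_image.1 he
  obtain ⟨t', ht', h⟩ := hw.2.2 t
  rw [walkMult]
  exact Finset.one_lt_card.2 ⟨t', by simp [(walkEdge_eq_iff w t t').2 h], t, by simp, ht'⟩

lemma sum_walkMult {n L : ℕ} (w : Fin (L + 1) → Fin n) : ∑ e, walkMult w e = L := by
  simp only [walkMult]
  rw [← Finset.card_eq_sum_card_fiberwise (fun _ _ => by simp)]
  simp

lemma IsDoubledWalk.two_mul_card_edges_le {n L : ℕ} {w : Fin (L + 1) → Fin n}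
    (hw : IsDoubledWalk w) : 2 * (Finset.univ.image (walkEdge w)).card ≤ L := by
  calc 2 * (Finset.univ.image (walkEdge w)).card
      = ∑ e ∈ Finset.univ.image (walkEdge w), 2 := by simp [mul_comm]
    _ ≤ ∑ e ∈ Finset.univ.image (walkEdge w), walkMult w e :=
        Finset.sum_le_sum fun e he => hw.two_le_walkMult he
    _ ≤ ∑ e, walkMult w e :=
        Finset.sum_le_sum_of_subset (Finset.subset_univ _)
    _ = L := sum_walkMult w

lemma exists_walkMult_eq_one {n L : ℕ} {w : Fin (L + 1) → Fin n}
    (h0 : w 0 = w (Fin.last L)) (hl : ∀ t : Fin L, w t.castSucc ≠ w t.succ)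
    (hw : ¬ IsDoubledWalk w) : ∃ e, walkMult w e = 1 := by
  have : ∃ t : Fin L, ∀ t' ≠ t, walkEdge w t' ≠ walkEdge w t := by
    by_contra! h
    exact hw ⟨h0, hl, fun t => (h t).imp fun t' h' => ⟨h'.1, (walkEdge_eq_iff w t t').1 h'.2⟩⟩
  obtain ⟨t, ht⟩ := this
  refine ⟨walkEdge w t, Finset.card_eq_one.2 ⟨t, ?_⟩⟩
  ext t'
  simp only [Finset.mem_filter, Finset.mem_univ, true_and, Finset.mem_singleton]
  exact ⟨fun h => by_contra fun h' => ht t' h' h, fun h => by rw [h]⟩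

lemma card_image_range_le_edges {α : Type*} [DecidableEq α] (w : ℕ → α) (L : ℕ) :
    ((Finset.range (L + 1)).image w).card ≤
      ((Finset.range L).image fun t => s(w t, w (t + 1))).card + 1 := by
  induction L with
  | zero => simp
  | succ L ih =>
    have e1 : (Finset.range (L + 1 + 1)).image w =
        insert (w (L + 1)) ((Finset.range (L + 1)).image w) := by
      rw [Finset.range_add_one, Finset.image_insert]
    have e2 : ((Finset.range (L + 1)).image fun t => s(w t, w (t + 1))) =
        insert s(w L, w (L + 1)) ((Finset.range L).image fun t => s(w t, w (t + 1))) := by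
      rw [Finset.range_add_one, Finset.image_insert]
    rw [e1, e2]
    by_cases h : w (L + 1) ∈ (Finset.range (L + 1)).image w
    · rw [Finset.insert_eq_of_mem h]
      exact ih.trans (Nat.add_le_add_right (Finset.card_le_card (Finset.subset_insert _ _)) 1)
    · rw [Finset.card_insert_of_notMem h, Finset.card_insert_of_notMem]
      · omega
      · intro h'
        obtain ⟨t, ht, e⟩ := Finset.mem_image.1 h'
        have hm : w (L + 1) ∈ s(w t, w (t + 1)) := by rw [e]; exact Sym2.mem_mk_right _ _
        rw [Finset.mem_range] at ht
        rcases Sym2.mem_iff.1 hm with h1 | h1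
        · exact h (Finset.mem_image.2 ⟨t, Finset.mem_range.2 (by omega), h1.symm⟩)
        · exact h (Finset.mem_image.2 ⟨t + 1, Finset.mem_range.2 (by omega), h1.symm⟩)

lemma card_image_le_card_edges {n L : ℕ} (w : Fin (L + 1) → Fin n) :
    (Finset.univ.image w).card ≤ (Finset.univ.image (walkEdge w)).card + 1 := by
  set w' : ℕ → Fin n := fun t => w ⟨min t L, by omega⟩ with hw'
  have e1 : Finset.univ.image w = (Finset.range (L + 1)).image w' := by
    ext a
    simp only [Finset.mem_image, Finset.mem_univ, true_and, Finset.mem_range, hw']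
    constructor
    · rintro ⟨t, rfl⟩
      exact ⟨t, t.2, congrArg w (Fin.ext (by simp; omega))⟩
    · rintro ⟨t, -, rfl⟩
      exact ⟨_, rfl⟩
  have e2 : ((Finset.range L).image fun t => s(w' t, w' (t + 1))) =
      (Finset.univ.image (walkEdge w)).image fun e => s(e.1, e.2) := by
    have h (t : Fin L) : s((walkEdge w t).1, (walkEdge w t).2) = s(w' t, w' (t + 1)) := by
      have h1 : w' t = w t.castSucc := congrArg w (Fin.ext (by simp))
      have h2 : w' (t + 1) = w t.succ := congrArg w (Fin.ext (by simp))
      rw [h1, h2, walkEdge]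
      rcases le_total (w t.castSucc) (w t.succ) with h | h
      · simp [h]
      · simp [h, Sym2.eq_swap]
    ext a
    simp only [Finset.mem_image, Finset.mem_univ, true_and, Finset.mem_range,
      exists_exists_eq_and, h]
    constructor
    · rintro ⟨t, ht, rfl⟩
      exact ⟨⟨t, ht⟩, rfl⟩
    · rintro ⟨t, rfl⟩
      exact ⟨t, t.2, rfl⟩
  rw [e1]
  refine (card_image_range_le_edges w' L).trans (Nat.add_le_add_right ?_ 1)
  rw [e2]
  exact Finset.card_image_le

lemma integral_trace_pow {n : ℕ} {P : Fin n → Fin n → ℝ}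
    (h0 : ∀ i j, 0 ≤ P i j) (h1 : ∀ i j, P i j ≤ 1) (L : ℕ) [DecidablePred
      (IsDoubledWalk : (Fin (L + 1) → Fin n) → Prop)] :
    ∫ ω, ((centeredAdj P ω) ^ L).trace ∂(bernProd P) =
      ∑ w : Fin (L + 1) → Fin n with IsDoubledWalk w,
        ∏ e : Fin n × Fin n, bernMoment (P e.1 e.2) (walkMult w e) := by
  simp only [Matrix.trace_pow_eq_sum_walks]
  rw [integral_finsetSum _ fun w _ => integrable_bernProd h0 h1 _, Finset.sum_filter]
  refine Finset.sum_congr rfl fun w _ => ?_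
  by_cases hc : w 0 = w (Fin.last L)
  · simp only [hc, if_true]
    by_cases hl : ∀ t : Fin L, w t.castSucc ≠ w t.succ
    · rw [integral_walk h0 h1 w hl]
      split_ifs with hw
      · rfl
      · obtain ⟨e, he⟩ := exists_walkMult_eq_one hc hl hw
        exact Finset.prod_eq_zero (Finset.mem_univ e) (by rw [he, bernMoment_one])
    · push Not at hl
      obtain ⟨t, ht⟩ := hl
      rw [integral_walk_of_loop P w ht, if_neg fun hw => hw.2.1 t ht]
  · simp only [hc, if_false, integral_zero]
    rw [if_neg fun hw => hc hw.1]

lemma integral_trace_pow_le {n : ℕ} {P : Fin n → Fin n → ℝ} {p : ℝ}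
    (h0 : ∀ i j, 0 ≤ P i j) (hp : ∀ i j, P i j ≤ p) (hp0 : 0 ≤ p) (hp1 : p ≤ 1) (L : ℕ)
    [DecidablePred (IsDoubledWalk : (Fin (L + 1) → Fin n) → Prop)] :
    ∫ ω, ((centeredAdj P ω) ^ L).trace ∂(bernProd P) ≤
      ∑ w : Fin (L + 1) → Fin n with IsDoubledWalk w, p ^ ((Finset.univ.image w).card - 1) := by
  have h1 : ∀ i j, P i j ≤ 1 := fun i j => (hp i j).trans hp1
  rw [integral_trace_pow h0 h1]
  refine Finset.sum_le_sum fun w hw => ?_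
  have hw : IsDoubledWalk w := (Finset.mem_filter.1 hw).2
  refine (le_abs_self _).trans ?_
  rw [Finset.abs_prod]
  calc ∏ e : Fin n × Fin n, |bernMoment (P e.1 e.2) (walkMult w e)|
      ≤ ∏ e : Fin n × Fin n, if e ∈ Finset.univ.image (walkEdge w) then p else 1 := by
        refine Finset.prod_le_prod (fun _ _ => abs_nonneg _) fun e _ => ?_
        split_ifs with he
        · exact (abs_bernMoment_le (h0 _ _) (h1 _ _) (hw.two_le_walkMult he)).trans (hp _ _)
        · rw [(walkMult_eq_zero_iff w e).2 he, bernMoment_zero, abs_one]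
    _ = p ^ (Finset.univ.image (walkEdge w)).card := by
        rw [Finset.prod_ite_mem, Finset.univ_inter, Finset.prod_const]
    _ ≤ p ^ ((Finset.univ.image w).card - 1) :=
        pow_le_pow_of_le_one hp0 hp1 (Nat.sub_le_iff_le_add.2 (card_image_le_card_edges w))

lemma card_doubledWalk_le {r : ℕ} (L : ℕ)
    [DecidablePred (IsDoubledWalk : (Fin (L + 1) → Fin r) → Prop)] :
    ((Finset.univ.filter fun w : Fin (L + 1) → Fin r => IsDoubledWalk w).card : ℝ) ≤
      3 ^ L * ∫ ω, ((centeredAdj (n := r) (fun _ _ => 1 / 3) ω) ^ L).trace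
        ∂(bernProd fun _ _ => 1 / 3) := by
  rw [integral_trace_pow (by norm_num) (by norm_num), Finset.card_eq_sum_ones, Nat.cast_sum,
    Finset.mul_sum]
  refine Finset.sum_le_sum fun w hw => ?_
  have hw : IsDoubledWalk w := (Finset.mem_filter.1 hw).2
  rw [Nat.cast_one]
  have h3 : (3 : ℝ) ^ L = ∏ e, 3 ^ walkMult w e := by
    rw [Finset.prod_pow_eq_pow_sum, sum_walkMult]
  rw [h3, ← Finset.prod_mul_distrib]
  refine Finset.one_le_prod fun e _ => ?_
  by_cases he : e ∈ Finset.univ.image (walkEdge w)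
  · exact one_le_bernMoment_third (hw.two_le_walkMult he)
  · rw [(walkMult_eq_zero_iff w e).2 he, bernMoment_zero]
    norm_num

lemma card_ker_eq {ι β : Type*} [Fintype ι] [DecidableEq ι] [Fintype β] (π : Setoid ι)
    [Fintype (Quotient π)] [DecidablePred fun w : ι → β => Setoid.ker w = π] :
    (Finset.univ.filter fun w : ι → β => Setoid.ker w = π).card =
      (Fintype.card β).descFactorial (Fintype.card (Quotient π)) := by
  classical
  rw [← Fintype.card_embedding_eq, ← Fintype.card_subtype]
  refine Fintype.card_congr
    { toFun := fun w => ⟨Quotient.lift w.1 fun a b h => ?_, fun a b => ?_⟩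
      invFun := fun f => ⟨fun i => f (Quotient.mk π i), ?_⟩
      left_inv := fun w => rfl
      right_inv := fun f => ?_ }
  · have : Setoid.ker w.1 a b := by rw [w.2]; exact h
    exact this
  · refine Quotient.inductionOn₂ a b fun a b h => Quotient.sound ?_
    have : Setoid.ker w.1 a b := h
    rwa [w.2] at this
  · ext a b
    rw [Setoid.ker_def, f.injective.eq_iff]
    exact Quotient.eq
  · ext a
    exact Quotient.inductionOn a fun a => rfl

lemma card_image_eq_card_quotient_ker {ι β : Type*} [Fintype ι] [DecidableEq β] (w : ι → β)
    [Fintype (Quotient (Setoid.ker w))] :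
    (Finset.univ.image w).card = Fintype.card (Quotient (Setoid.ker w)) := by
  classical
  rw [Fintype.card_congr (Setoid.quotientKerEquivRange w), ← Set.toFinset_card, Set.toFinset_range]

lemma isDoubledWalk_congr {α β : Type*} {L : ℕ} {w : Fin (L + 1) → α} {w' : Fin (L + 1) → β}
    (h : Setoid.ker w = Setoid.ker w') : IsDoubledWalk w ↔ IsDoubledWalk w' := by
  have h' (a b : Fin (L + 1)) : w a = w b ↔ w' a = w' b := by
    rw [← Setoid.ker_def, h, Setoid.ker_def]
  simp only [IsDoubledWalk, Sym2.eq_iff, ne_eq, h']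

lemma sum_doubledWalk_le {n r k : ℕ} {p : ℝ} (hp : 0 ≤ p) (hr : (n : ℝ) * p + k ≤ r)
    (hkr : k < r)
    [DecidablePred (IsDoubledWalk : (Fin (2 * k + 1) → Fin n) → Prop)]
    [DecidablePred (IsDoubledWalk : (Fin (2 * k + 1) → Fin r) → Prop)] :
    ∑ w : Fin (2 * k + 1) → Fin n with IsDoubledWalk w, p ^ ((Finset.univ.image w).card - 1) ≤
      n * ((Finset.univ.filter fun w : Fin (2 * k + 1) → Fin r => IsDoubledWalk w).card : ℝ) := by
  classical
  have : Finite (Setoid (Fin (2 * k + 1))) := Finite.of_injective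
    (fun π : Setoid (Fin (2 * k + 1)) => fun a b => π a b)
    fun π π' h => Setoid.ext fun a b => iff_of_eq (congrFun (congrFun h a) b)
  have : Fintype (Setoid (Fin (2 * k + 1))) := Fintype.ofFinite _
  rw [← Finset.sum_fiberwise (s := Finset.univ.filter fun w : Fin (2 * k + 1) → Fin n =>
      IsDoubledWalk w) (g := fun w => Setoid.ker w),
    Finset.card_eq_sum_card_fiberwise (s := Finset.univ.filter fun w : Fin (2 * k + 1) → Fin r =>
      IsDoubledWalk w) (f := fun w => Setoid.ker w) (t := Finset.univ) (fun _ _ => by simp),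
    Nat.cast_sum, Finset.mul_sum]
  refine Finset.sum_le_sum fun π _ => ?_
  by_cases hπ : ∃ w₀ : Fin (2 * k + 1) → Fin n, IsDoubledWalk w₀ ∧ Setoid.ker w₀ = π
  · obtain ⟨w₀, hw₀, hker⟩ := hπ
    set m := Fintype.card (Quotient π) with hm
    have hm1 : 1 ≤ m := Fintype.card_pos_iff.2 ⟨Quotient.mk π 0⟩
    have hcard : (Finset.univ.image w₀).card = m := by
      subst hker
      exact card_image_eq_card_quotient_ker w₀
    have hmk : m ≤ k + 1 := by
      have h1 := card_image_le_card_edges w₀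
      have h2 := hw₀.two_mul_card_edges_le
      omega
    have hrsub : ((r - k : ℕ) : ℝ) = r - k := Nat.cast_sub hkr.le
    have hrk : (n : ℝ) * p ≤ (r - k : ℕ) := by rw [hrsub]; linarith
    have e1 : (Finset.univ.filter fun w : Fin (2 * k + 1) → Fin r => IsDoubledWalk w).filter
        (fun w => Setoid.ker w = π) = Finset.univ.filter (fun w => Setoid.ker w = π) := by
      ext w
      simp only [Finset.mem_filter, Finset.mem_univ, true_and, and_iff_right_iff_imp]
      intro h
      exact (isDoubledWalk_congr (hker.trans h.symm)).1 hw₀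
    rw [e1, card_ker_eq, Fintype.card_fin, ← hm]
    calc ∑ w ∈ (Finset.univ.filter fun w : Fin (2 * k + 1) → Fin n => IsDoubledWalk w) with
          Setoid.ker w = π, p ^ ((Finset.univ.image w).card - 1)
        ≤ ∑ w : Fin (2 * k + 1) → Fin n with Setoid.ker w = π, p ^ (m - 1) := by
          refine (Finset.sum_le_sum fun w hw => ?_).trans
            (Finset.sum_le_sum_of_subset_of_nonneg
              (Finset.filter_subset_filter _ (Finset.filter_subset _ _))
              fun _ _ _ => pow_nonneg hp _)
          have hw : Setoid.ker w = π := (Finset.mem_filter.1 hw).2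
          rw [card_image_eq_card_quotient_ker]
          simp only [hw, hm, le_refl]
      _ = (n.descFactorial m : ℝ) * p ^ (m - 1) := by
          rw [Finset.sum_const, card_ker_eq, Fintype.card_fin, nsmul_eq_mul]
      _ ≤ (n : ℝ) ^ m * p ^ (m - 1) := by
          gcongr
          exact_mod_cast Nat.descFactorial_le_pow n m
      _ = n * (n * p) ^ (m - 1) := by
          rw [mul_pow, ← mul_assoc, ← pow_succ', Nat.sub_add_cancel hm1]
      _ ≤ n * ((r - k : ℕ) : ℝ) ^ (m - 1) := by gcongr
      _ ≤ n * ((r - k : ℕ) : ℝ) ^ m := by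
          gcongr
          · exact_mod_cast (by omega : 1 ≤ r - k)
          · omega
      _ ≤ n * (r.descFactorial m : ℝ) := by
          gcongr
          have h1 : (r - k) ^ m ≤ (r + 1 - m) ^ m := Nat.pow_le_pow_left (by omega) m
          exact_mod_cast h1.trans (Nat.pow_sub_le_descFactorial r m)
  · rw [Finset.sum_eq_zero]
    · positivity
    · intro w hw
      simp only [Finset.mem_filter, Finset.mem_univ, true_and] at hw
      exact (hπ ⟨w, hw⟩).elim

lemma integral_trace_pow_le_third {n r k : ℕ} {P : Fin n → Fin n → ℝ} {p : ℝ}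
    (h0 : ∀ i j, 0 ≤ P i j) (hp : ∀ i j, P i j ≤ p) (hp0 : 0 ≤ p) (hp1 : p ≤ 1)
    (hr : (n : ℝ) * p + k ≤ r) (hkr : k < r) :
    ∫ ω, ((centeredAdj P ω) ^ (2 * k)).trace ∂(bernProd P) ≤
      n * (9 ^ k * ∫ ω, ((centeredAdj (n := r) (fun _ _ => 1 / 3) ω) ^ (2 * k)).trace
        ∂(bernProd fun _ _ => 1 / 3)) := by
  classical
  refine (integral_trace_pow_le h0 hp hp0 hp1 _).trans ((sum_doubledWalk_le hp0 hr hkr).trans ?_)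
  gcongr
  have := card_doubledWalk_le (r := r) (2 * k)
  rwa [pow_mul, show (3 : ℝ) ^ 2 = 9 by norm_num] at this

section SpectralNorm

open scoped Matrix.Norms.L2Operator

lemma Matrix.trace_pow_two_mul {r : ℕ} {M : Matrix (Fin r) (Fin r) ℝ} (hM : M.IsSymm) (k : ℕ) :
    (M ^ (2 * k)).trace = ∑ i, ∑ j, (M ^ k) i j ^ 2 := by
  have h : (M ^ k).IsSymm := hM.pow k
  rw [two_mul, pow_add]
  simp only [Matrix.trace, Matrix.diag_apply, Matrix.mul_apply, sq]
  refine Finset.sum_congr rfl fun i _ => Finset.sum_congr rfl fun j _ => ?_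
  rw [h.apply i j]

lemma Matrix.l2_opNorm_sq_le_sum_sq {r : ℕ} (B : Matrix (Fin r) (Fin r) ℝ) :
    ‖B‖ ^ 2 ≤ ∑ i, ∑ j, B i j ^ 2 := by
  have hS : 0 ≤ ∑ i, ∑ j, B i j ^ 2 :=
    Finset.sum_nonneg fun i _ => Finset.sum_nonneg fun j _ => sq_nonneg _
  have : ‖B‖ ≤ √(∑ i, ∑ j, B i j ^ 2) := by
    rw [Matrix.cstar_norm_def]
    refine ContinuousLinearMap.opNorm_le_bound _ (Real.sqrt_nonneg _) fun x => ?_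
    rw [EuclideanSpace.norm_eq, EuclideanSpace.norm_eq x, ← Real.sqrt_mul hS]
    refine Real.sqrt_le_sqrt ?_
    simp only [Matrix.ofLp_toEuclideanCLM, Real.norm_eq_abs, sq_abs, Finset.sum_mul]
    refine Finset.sum_le_sum fun i _ => ?_
    rw [← Finset.sum_mul]
    exact Finset.sum_mul_sq_le_sq_mul_sq Finset.univ (B i) x.ofLp
  exact (Real.le_sqrt (norm_nonneg _) hS).1 this

lemma Matrix.sum_sq_le_l2_opNorm_sq {r : ℕ} (B : Matrix (Fin r) (Fin r) ℝ) :
    ∑ i, ∑ j, B i j ^ 2 ≤ r * ‖B‖ ^ 2 := by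
  rw [Finset.sum_comm]
  calc ∑ j, ∑ i, B i j ^ 2 ≤ ∑ j : Fin r, ‖B‖ ^ 2 := by
        refine Finset.sum_le_sum fun j _ => ?_
        have h := B.l2_opNorm_mulVec (EuclideanSpace.single j 1)
        rw [PiLp.norm_single, norm_one, mul_one, EuclideanSpace.norm_eq] at h
        have h2 := (Real.sqrt_le_left (norm_nonneg _)).1 h
        simpa using h2
    _ = r * ‖B‖ ^ 2 := by simp

lemma Matrix.IsSymm.norm_pow_two_pow {r : ℕ} {M : Matrix (Fin r) (Fin r) ℝ} (hM : M.IsSymm)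
    (a : ℕ) : ‖M ^ 2 ^ a‖ = ‖M‖ ^ 2 ^ a := by
  have : IsSelfAdjoint M := by
    rw [IsSelfAdjoint, Matrix.star_eq_conjTranspose, Matrix.conjTranspose_eq_transpose_of_trivial]
    exact hM
  exact this.norm_pow_two_pow a

lemma Matrix.IsSymm.norm_pow_le_trace {r : ℕ} {M : Matrix (Fin r) (Fin r) ℝ} (hM : M.IsSymm)
    (a : ℕ) : ‖M‖ ^ (2 * 2 ^ a) ≤ (M ^ (2 * 2 ^ a)).trace := by
  rw [Matrix.trace_pow_two_mul hM, mul_comm 2, pow_mul, ← hM.norm_pow_two_pow]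
  exact Matrix.l2_opNorm_sq_le_sum_sq _

lemma Matrix.IsSymm.trace_le_norm_pow {r : ℕ} {M : Matrix (Fin r) (Fin r) ℝ} (hM : M.IsSymm)
    (a : ℕ) : (M ^ (2 * 2 ^ a)).trace ≤ r * ‖M‖ ^ (2 * 2 ^ a) := by
  rw [Matrix.trace_pow_two_mul hM, mul_comm 2, pow_mul, ← hM.norm_pow_two_pow]
  exact Matrix.sum_sq_le_l2_opNorm_sq _

lemma isSymm_centeredAdj {n : ℕ} (P : Fin n → Fin n → ℝ) (ω : Fin n → Fin n → Bool) :
    (centeredAdj P ω).IsSymm := by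
  ext i j
  simp only [Matrix.transpose_apply, centeredAdj, Matrix.of_apply, eq_comm, min_comm, max_comm]

lemma exists_half_net (r : ℕ) : ∃ N : Finset (EuclideanSpace ℝ (Fin r)), N.card ≤ 5 ^ r ∧
    (∀ x ∈ N, ‖x‖ ≤ 1) ∧ ∀ x : EuclideanSpace ℝ (Fin r), ‖x‖ ≤ 1 → ∃ y ∈ N, ‖x - y‖ ≤ 1 / 2 := by
  classical
  let S : Set ℕ := {m | ∃ s : Finset (EuclideanSpace ℝ (Fin r)), s.card = m ∧
    (∀ c ∈ s, ‖c‖ ≤ 2) ∧ ∀ c ∈ s, ∀ d ∈ s, c ≠ d → 1 ≤ ‖c - d‖}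
  have hb : ∀ m ∈ S, m ≤ 5 ^ r := by
    rintro m ⟨s, rfl, h1, h2⟩
    simpa using Besicovitch.card_le_of_separated s h1 h2
  have hne : S.Nonempty := ⟨0, ∅, by simp⟩
  have hmem := Nat.sSup_mem hne ⟨_, hb⟩
  have hmax : ∀ m ∈ S, m ≤ sSup S := fun m hm => le_csSup ⟨_, hb⟩ hm
  obtain ⟨s, hs, h1, h2⟩ := hmem
  refine ⟨s.image fun c => (1 / 2 : ℝ) • c, ?_, ?_, ?_⟩
  · exact Finset.card_image_le.trans (by simpa using Besicovitch.card_le_of_separated s h1 h2)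
  · intro x hx
    obtain ⟨c, hc, rfl⟩ := Finset.mem_image.1 hx
    rw [norm_smul, Real.norm_of_nonneg (by norm_num)]
    linarith [h1 c hc]
  · intro x hx
    have hx2 : ‖(2 : ℝ) • x‖ ≤ 2 := by
      rw [norm_smul, Real.norm_of_nonneg (by norm_num)]
      linarith
    obtain ⟨c, hc, h⟩ : ∃ c ∈ s, ‖(2 : ℝ) • x - c‖ ≤ 1 := by
      by_contra! h
      have hxs : (2 : ℝ) • x ∉ s := fun hxs => by
        have := h _ hxs
        simp at this
        linarith
      have := hmax (s.card + 1) ⟨insert ((2 : ℝ) • x) s, Finset.card_insert_of_notMem hxs, ?_, ?_⟩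
      · omega
      · intro c hc
        rcases Finset.mem_insert.1 hc with rfl | hc
        · exact hx2
        · exact h1 c hc
      · intro c hc d hd hcd
        rcases Finset.mem_insert.1 hc with rfl | hc <;> rcases Finset.mem_insert.1 hd with rfl | hd
        · exact (hcd rfl).elim
        · exact (h d hd).le
        · rw [norm_sub_rev]
          exact (h c hc).le
        · exact h2 c hc d hd hcd
    refine ⟨(1 / 2 : ℝ) • c, Finset.mem_image_of_mem _ hc, ?_⟩
    have : x - (1 / 2 : ℝ) • c = (1 / 2 : ℝ) • ((2 : ℝ) • x - c) := by
      rw [smul_sub, smul_smul]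
      norm_num
    rw [this, norm_smul, Real.norm_of_nonneg (by norm_num)]
    linarith

lemma Matrix.exists_norm_le_of_half_net {r : ℕ} {N : Finset (EuclideanSpace ℝ (Fin r))}
    (hN : ∀ x : EuclideanSpace ℝ (Fin r), ‖x‖ ≤ 1 → ∃ y ∈ N, ‖x - y‖ ≤ 1 / 2)
    (M : Matrix (Fin r) (Fin r) ℝ) :
    ∃ z ∈ N ×ˢ N, ‖M‖ ≤ 4 * ∑ i, ∑ j, z.1 i * z.2 j * M i j := by
  have hform (x y : EuclideanSpace ℝ (Fin r)) :
      inner ℝ x (Matrix.toEuclideanCLM (𝕜 := ℝ) M y) = ∑ i, ∑ j, x i * y j * M i j := by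
    rw [Matrix.inner_toEuclideanCLM]
    simp only [dotProduct, Matrix.mulVec, Finset.mul_sum]
    exact Finset.sum_congr rfl fun i _ => Finset.sum_congr rfl fun j _ => by ring
  have hne : (N ×ˢ N).Nonempty := by
    obtain ⟨y, hy, -⟩ := hN 0 (by simp)
    exact ⟨(y, y), Finset.mem_product.2 ⟨hy, hy⟩⟩
  obtain ⟨z, hz, hmax⟩ := (N ×ˢ N).exists_max_image
    (fun z => inner ℝ z.1 (Matrix.toEuclideanCLM (𝕜 := ℝ) M z.2)) hne
  refine ⟨z, hz, ?_⟩
  rw [← hform, Matrix.cstar_norm_def]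
  set T := Matrix.toEuclideanCLM (𝕜 := ℝ) M with hT
  set V := inner ℝ z.1 (T z.2) with hV
  have hTy (y) (hy : y ∈ N) : ‖T y‖ ≤ 2 * V := by
    rcases eq_or_ne (T y) 0 with h0 | h0
    · obtain ⟨x, hx, -⟩ := hN 0 (by simp)
      have := hmax (x, y) (Finset.mem_product.2 ⟨hx, hy⟩)
      simp only [h0, inner_zero_right] at this
      rw [h0, norm_zero]
      linarith
    · have hpos : 0 < ‖T y‖ := norm_pos_iff.2 h0
      set u := ‖T y‖⁻¹ • T y with hu
      have hu1 : ‖u‖ ≤ 1 := by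
        rw [hu, norm_smul, norm_inv, norm_norm, inv_mul_cancel₀ hpos.ne']
      obtain ⟨x, hx, hxu⟩ := hN u hu1
      have h1 : inner ℝ u (T y) = ‖T y‖ := by
        rw [hu, real_inner_smul_left, real_inner_self_eq_norm_sq]
        field_simp
      have h2 : inner ℝ (u - x) (T y) ≤ 1 / 2 * ‖T y‖ :=
        (real_inner_le_norm _ _).trans (by gcongr)
      have h3 := hmax (x, y) (Finset.mem_product.2 ⟨hx, hy⟩)
      rw [inner_sub_left] at h2
      simp only at h3
      linarith
  have hV0 : 0 ≤ V := by
    have := hTy z.2 (Finset.mem_product.1 hz).2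
    linarith [norm_nonneg (T z.2)]
  have : ‖T‖ ≤ 2 * V + ‖T‖ / 2 := by
    refine ContinuousLinearMap.opNorm_le_of_unit_norm (by positivity) fun y hy => ?_
    obtain ⟨y₀, hy₀, hyy⟩ := hN y hy.le
    calc ‖T y‖ = ‖T y₀ + T (y - y₀)‖ := by rw [← map_add, add_sub_cancel]
      _ ≤ ‖T y₀‖ + ‖T (y - y₀)‖ := norm_add_le _ _
      _ ≤ 2 * V + ‖T‖ * (1 / 2) := add_le_add (hTy y₀ hy₀) ((T.le_opNorm _).trans (by gcongr))
      _ = _ := by ring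
  linarith

lemma Real.exp_le_add_exp_sq (x : ℝ) : Real.exp x ≤ x + Real.exp (x ^ 2) := by
  have h2 : x ^ 2 + 1 ≤ Real.exp (x ^ 2) := Real.add_one_le_exp _
  rcases le_or_gt |x| 1 with h | h
  · have h1 := (abs_le.1 (Real.abs_exp_sub_one_sub_id_le h)).2
    linarith
  · rcases le_or_gt 0 x with h0 | h0
    · rw [abs_of_nonneg h0] at h
      have : Real.exp x ≤ Real.exp (x ^ 2) := Real.exp_le_exp.2 (by nlinarith)
      linarith
    · rw [abs_of_neg h0] at h
      have : Real.exp x ≤ 1 := Real.exp_le_one_iff.2 h0.le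
      nlinarith

lemma bern_mgf_le_exp_sq {p : ℝ} (h0 : 0 ≤ p) (h1 : p ≤ 1) (c : ℝ) :
    (1 - p) * Real.exp (c * (0 - p)) + p * Real.exp (c * (1 - p)) ≤ Real.exp (c ^ 2) := by
  have e1 : Real.exp (c * (0 - p)) ≤ c * (0 - p) + Real.exp (c ^ 2) := by
    refine (Real.exp_le_add_exp_sq _).trans (add_le_add le_rfl (Real.exp_le_exp.2 ?_))
    rw [mul_pow]
    exact mul_le_of_le_one_right (sq_nonneg c) (by nlinarith)
  have e2 : Real.exp (c * (1 - p)) ≤ c * (1 - p) + Real.exp (c ^ 2) := by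
    refine (Real.exp_le_add_exp_sq _).trans (add_le_add le_rfl (Real.exp_le_exp.2 ?_))
    rw [mul_pow]
    exact mul_le_of_le_one_right (sq_nonneg c) (by nlinarith)
  have h1' : 0 ≤ 1 - p := by linarith
  calc _ ≤ (1 - p) * (c * (0 - p) + Real.exp (c ^ 2)) +
        p * (c * (1 - p) + Real.exp (c ^ 2)) := by gcongr
    _ = Real.exp (c ^ 2) := by ring

lemma bern_mgf_le_exp_mul {p : ℝ} (h0 : 0 ≤ p) (h1 : p ≤ 1) {c : ℝ} (hc : |c| ≤ 1) :
    (1 - p) * Real.exp (c * (0 - p)) + p * Real.exp (c * (1 - p)) ≤ Real.exp (p * c ^ 2) := by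
  have key (y : ℝ) (hy : |y| ≤ 1) : Real.exp (c * y) ≤ 1 + c * y + (c * y) ^ 2 := by
    have h : |c * y| ≤ 1 := by
      rw [abs_mul]
      exact mul_le_one₀ hc (abs_nonneg _) hy
    linarith [(abs_le.1 (Real.abs_exp_sub_one_sub_id_le h)).2]
  have e1 := key (0 - p) (abs_le.2 ⟨by linarith, by linarith⟩)
  have e2 := key (1 - p) (abs_le.2 ⟨by linarith, by linarith⟩)
  have h1' : 0 ≤ 1 - p := by linarith
  calc _ ≤ (1 - p) * (1 + c * (0 - p) + (c * (0 - p)) ^ 2) +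
        p * (1 + c * (1 - p) + (c * (1 - p)) ^ 2) := by gcongr
    _ = 1 + p * c ^ 2 - (p * c) ^ 2 := by ring
    _ ≤ p * c ^ 2 + 1 := by nlinarith [sq_nonneg (p * c)]
    _ ≤ Real.exp (p * c ^ 2) := Real.add_one_le_exp _

lemma sum_mul_centeredAdj {n : ℕ} (P : Fin n → Fin n → ℝ) (a : Fin n → Fin n → ℝ)
    (ω : Fin n → Fin n → Bool) :
    ∑ i, ∑ j, a i j * centeredAdj P ω i j =
      ∑ i, ∑ j, if i < j then (a i j + a j i) * ((if ω i j then 1 else 0) - P i j) else 0 := by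
  have h (i j : Fin n) : a i j * centeredAdj P ω i j =
      (if i < j then a i j * ((if ω i j then 1 else 0) - P i j) else 0) +
      (if j < i then a i j * ((if ω j i then 1 else 0) - P j i) else 0) := by
    rcases lt_trichotomy i j with h | h | h
    · simp [centeredAdj, h, h.le, h.ne, h.not_gt]
    · simp [centeredAdj, h]
    · simp [centeredAdj, h, h.le, h.ne', h.not_gt]
  simp only [h, Finset.sum_add_distrib]
  rw [Finset.sum_comm (f := fun i j =>
    if j < i then a i j * ((if ω j i then 1 else 0) - P j i) else 0), ← Finset.sum_add_distrib]
  refine Finset.sum_congr rfl fun i _ => ?_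
  rw [← Finset.sum_add_distrib]
  refine Finset.sum_congr rfl fun j _ => ?_
  split_ifs <;> ring

lemma integral_exp_sum_le {n : ℕ} {P : Fin n → Fin n → ℝ} (h0 : ∀ i j, 0 ≤ P i j)
    (h1 : ∀ i j, P i j ≤ 1) (a b : Fin n → Fin n → ℝ)
    (hb : ∀ i j, i < j → (1 - P i j) * Real.exp ((a i j + a j i) * (0 - P i j)) +
      P i j * Real.exp ((a i j + a j i) * (1 - P i j)) ≤ Real.exp (b i j)) :
    ∫ ω, Real.exp (∑ i, ∑ j, a i j * centeredAdj P ω i j) ∂(bernProd P) ≤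
      Real.exp (∑ i, ∑ j, if i < j then b i j else 0) := by
  simp only [sum_mul_centeredAdj, Real.exp_sum]
  rw [integral_bernProd_prod h0 h1 (g := fun i j y => Real.exp
    (if i < j then (a i j + a j i) * ((if y then 1 else 0) - P i j) else 0))]
  have hpos (i j : Fin n) : 0 ≤ 1 - P i j := by linarith [h1 i j]
  have hnn (i j : Fin n) : 0 ≤ (1 - P i j) * Real.exp (if i < j then
      (a i j + a j i) * ((if false then 1 else 0) - P i j) else 0) + P i j * Real.exp
      (if i < j then (a i j + a j i) * ((if true then 1 else 0) - P i j) else 0) :=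
    add_nonneg (mul_nonneg (hpos i j) (Real.exp_pos _).le)
      (mul_nonneg (h0 i j) (Real.exp_pos _).le)
  refine Finset.prod_le_prod (fun i _ => Finset.prod_nonneg fun j _ => hnn i j) fun i _ =>
    Finset.prod_le_prod (fun j _ => hnn i j) fun j _ => ?_
  by_cases hij : i < j
  · simpa [hij] using hb i j hij
  · simp [hij]

lemma integral_exp_bilin_le {n : ℕ} {P : Fin n → Fin n → ℝ} (h0 : ∀ i j, 0 ≤ P i j)
    (h1 : ∀ i j, P i j ≤ 1) (lam : ℝ) {x y : EuclideanSpace ℝ (Fin n)} (hx : ‖x‖ ≤ 1)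
    (hy : ‖y‖ ≤ 1) :
    ∫ ω, Real.exp (lam * ∑ i, ∑ j, x i * y j * centeredAdj P ω i j) ∂(bernProd P) ≤
      Real.exp (2 * lam ^ 2) := by
  have hsq {z : EuclideanSpace ℝ (Fin n)} (hz : ‖z‖ ≤ 1) : ∑ i, z i ^ 2 ≤ 1 := by
    rw [← EuclideanSpace.real_norm_sq_eq]
    exact pow_le_one₀ (norm_nonneg _) hz
  have h := integral_exp_sum_le h0 h1 (fun i j => lam * (x i * y j))
    (fun i j => (lam * (x i * y j) + lam * (x j * y i)) ^ 2)
    fun i j _ => bern_mgf_le_exp_sq (h0 i j) (h1 i j) _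
  simp only [Finset.mul_sum, ← mul_assoc] at h ⊢
  refine h.trans (Real.exp_le_exp.2 ?_)
  calc ∑ i, ∑ j, (if i < j then (lam * x i * y j + lam * x j * y i) ^ 2 else 0)
      ≤ ∑ i, ∑ j, ((if i < j then 2 * lam ^ 2 * (x i ^ 2 * y j ^ 2) else 0) +
        (if i < j then 2 * lam ^ 2 * (x j ^ 2 * y i ^ 2) else 0)) := by
        refine Finset.sum_le_sum fun i _ => Finset.sum_le_sum fun j _ => ?_
        split_ifs
        · nlinarith [sq_nonneg (lam * x i * y j - lam * x j * y i)]
        · simp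
    _ = ∑ i, ∑ j, ((if i < j then 2 * lam ^ 2 * (x i ^ 2 * y j ^ 2) else 0) +
        (if j < i then 2 * lam ^ 2 * (x i ^ 2 * y j ^ 2) else 0)) := by
        simp only [Finset.sum_add_distrib]
        congr 1
        rw [Finset.sum_comm]
    _ ≤ ∑ i, ∑ j, 2 * lam ^ 2 * (x i ^ 2 * y j ^ 2) := by
        refine Finset.sum_le_sum fun i _ => Finset.sum_le_sum fun j _ => ?_
        have : 0 ≤ 2 * lam ^ 2 * (x i ^ 2 * y j ^ 2) := by positivity
        split_ifs with h1 h2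
        · exact (lt_asymm h1 h2).elim
        all_goals linarith
    _ = 2 * lam ^ 2 * ((∑ i, x i ^ 2) * ∑ j, y j ^ 2) := by
        rw [Finset.sum_mul_sum, Finset.mul_sum]
        simp only [Finset.mul_sum]
    _ ≤ 2 * lam ^ 2 * (1 * 1) :=
        mul_le_mul_of_nonneg_left (mul_le_mul (hsq hx) (hsq hy)
          (Finset.sum_nonneg fun i _ => sq_nonneg (y i)) zero_le_one) (by positivity)
    _ = 2 * lam ^ 2 := by ring

lemma integral_exp_norm_le {n : ℕ} {P : Fin n → Fin n → ℝ} (h0 : ∀ i j, 0 ≤ P i j)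
    (h1 : ∀ i j, P i j ≤ 1) {lam : ℝ} (hlam : 0 ≤ lam) :
    ∫ ω, Real.exp (lam * ‖centeredAdj P ω‖) ∂(bernProd P) ≤
      25 ^ n * Real.exp (32 * lam ^ 2) := by
  obtain ⟨N, hcard, hN1, hN⟩ := exists_half_net n
  calc ∫ ω, Real.exp (lam * ‖centeredAdj P ω‖) ∂(bernProd P)
      ≤ ∫ ω, ∑ z ∈ N ×ˢ N, Real.exp (4 * lam * ∑ i, ∑ j, z.1 i * z.2 j * centeredAdj P ω i j)
          ∂(bernProd P) := by
        refine integral_mono (integrable_bernProd h0 h1 _) (integrable_bernProd h0 h1 _) fun ω => ?_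
        obtain ⟨z, hz, h⟩ := Matrix.exists_norm_le_of_half_net hN (centeredAdj P ω)
        refine le_trans (Real.exp_le_exp.2 ?_) (Finset.single_le_sum (f := fun z :
          EuclideanSpace ℝ (Fin n) × EuclideanSpace ℝ (Fin n) => Real.exp
          (4 * lam * ∑ i, ∑ j, z.1 i * z.2 j * centeredAdj P ω i j))
          (fun _ _ => (Real.exp_pos _).le) hz)
        calc _ ≤ lam * (4 * ∑ i, ∑ j, z.1 i * z.2 j * centeredAdj P ω i j) := by gcongr
          _ = _ := by ring
    _ = ∑ z ∈ N ×ˢ N, ∫ ω, Real.exp (4 * lam * ∑ i, ∑ j, z.1 i * z.2 j * centeredAdj P ω i j)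
          ∂(bernProd P) := integral_finsetSum _ fun _ _ => integrable_bernProd h0 h1 _
    _ ≤ ∑ z ∈ N ×ˢ N, Real.exp (2 * (4 * lam) ^ 2) := Finset.sum_le_sum fun z hz =>
        integral_exp_bilin_le h0 h1 _ (hN1 _ (Finset.mem_product.1 hz).1)
          (hN1 _ (Finset.mem_product.1 hz).2)
    _ = (N.card * N.card : ℝ) * Real.exp (32 * lam ^ 2) := by
        rw [Finset.sum_const, Finset.card_product, nsmul_eq_mul, Nat.cast_mul]
        congr 2
        ring
    _ ≤ ((5 : ℝ) ^ n * 5 ^ n) * Real.exp (32 * lam ^ 2) := by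
        have : (N.card : ℝ) ≤ 5 ^ n := by exact_mod_cast hcard
        gcongr
    _ = _ := by rw [← mul_pow]; norm_num

lemma integral_norm_pow_le {r : ℕ} {P : Fin r → Fin r → ℝ} (h0 : ∀ i j, 0 ≤ P i j)
    (h1 : ∀ i j, P i j ≤ 1) (hr : 0 < r) :
    ∫ ω, ‖centeredAdj P ω‖ ^ r ∂(bernProd P) ≤ 800 ^ r * √r ^ r := by
  have hs : 0 < √(r : ℝ) := Real.sqrt_pos.2 (by exact_mod_cast hr)
  have hss : √(r : ℝ) * √r = r := Real.mul_self_sqrt (Nat.cast_nonneg r)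
  have he : Real.exp 2 ≤ 8 := by
    have h1 : Real.exp 1 ≤ 2.7182818286 := Real.exp_one_lt_d9.le
    calc Real.exp 2 = Real.exp 1 ^ 2 := by rw [← Real.exp_nat_mul]; norm_num
      _ ≤ 2.7182818286 ^ 2 := by gcongr
      _ ≤ 8 := by norm_num
  have key (t : ℝ) (ht : 0 ≤ t) : t ^ r ≤ 4 ^ r * √r ^ r * Real.exp (√r / 4 * t) := by
    have h1 := Real.pow_div_factorial_le_exp (√r / 4 * t) (by positivity) r
    rw [div_le_iff₀ (by positivity)] at h1
    have h2 : ((r.factorial : ℕ) : ℝ) ≤ (√r * √r) ^ r := by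
      rw [hss]
      exact_mod_cast Nat.factorial_le_pow r
    have h3 : (√r / 4 * t) ^ r ≤ Real.exp (√r / 4 * t) * (√r * √r) ^ r :=
      h1.trans (by gcongr)
    have h4 : t ^ r = 4 ^ r * ((√r / 4 * t) ^ r / √r ^ r) := by
      rw [← div_pow, ← mul_pow]
      congr 1
      field_simp
    have h5 : (√r / 4 * t) ^ r / √r ^ r ≤ √r ^ r * Real.exp (√r / 4 * t) := by
      rw [div_le_iff₀ (by positivity)]
      calc _ ≤ _ := h3
        _ = _ := by rw [mul_pow]; ring
    rw [h4, mul_assoc]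
    gcongr
  calc ∫ ω, ‖centeredAdj P ω‖ ^ r ∂(bernProd P)
      ≤ ∫ ω, 4 ^ r * √r ^ r * Real.exp (√r / 4 * ‖centeredAdj P ω‖) ∂(bernProd P) :=
        integral_mono (integrable_bernProd h0 h1 _) (integrable_bernProd h0 h1 _)
          fun ω => key _ (norm_nonneg _)
    _ = 4 ^ r * √r ^ r * ∫ ω, Real.exp (√r / 4 * ‖centeredAdj P ω‖) ∂(bernProd P) :=
        integral_const_mul _ _
    _ ≤ 4 ^ r * √r ^ r * (25 ^ r * Real.exp (32 * (√r / 4) ^ 2)) := by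
        gcongr
        exact integral_exp_norm_le h0 h1 (by positivity)
    _ = 4 ^ r * √r ^ r * (25 ^ r * Real.exp 2 ^ r) := by
        have h2 : 32 * (√(r : ℝ) / 4) ^ 2 = r * 2 := by
          rw [div_pow, sq, hss]
          ring
        rw [← Real.exp_nat_mul, h2]
    _ ≤ 4 ^ r * √r ^ r * (25 ^ r * 8 ^ r) := by gcongr
    _ = (4 * (25 * 8)) ^ r * √r ^ r := by
        rw [mul_pow, mul_pow]
        ring
    _ = 800 ^ r * √r ^ r := by norm_num

/-- High-probability bound for the spectral norm of a centered adjacency matrix. -/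
lemma measureReal_norm_centeredAdj_gt_le {n : ℕ} {P : Fin n → Fin n → ℝ} {p : ℝ}
    (h0 : ∀ i j, 0 ≤ P i j) (hp : ∀ i j, P i j ≤ p) (hp0 : 0 ≤ p) (hp1 : p ≤ 1) (hn : 1 ≤ n)
    (hnp : 1 ≤ n * p) (hlog : Real.log n ≤ n * p) :
    (bernProd P).real {ω | 38400 * √(n * p) ≤ ‖centeredAdj P ω‖} ≤ 1 / n := by
  have h1 : ∀ i j, P i j ≤ 1 := fun i j => (hp i j).trans hp1
  have hn0 : (0 : ℝ) < n := by exact_mod_cast hn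
  have := isProbabilityMeasure_bernProd h0 h1
  obtain ⟨a, ha1, ha2⟩ := exists_nat_pow_near hnp (one_lt_two (α := ℝ))
  obtain ⟨k, hk⟩ : ∃ k, k = 2 ^ (a + 1) := ⟨_, rfl⟩
  have hkR : (k : ℝ) = 2 ^ (a + 1) := by rw [hk]; push_cast; rfl
  have hk1 : n * p ≤ k := by rw [hkR]; exact ha2.le
  have hk2 : (k : ℝ) ≤ 2 * (n * p) := by
    rw [hkR, pow_succ]
    linarith
  have hk0 : 0 < k := by rw [hk]; positivity
  have hk0' : (1 : ℝ) ≤ k := by exact_mod_cast hk0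
  have t0 : ∀ i j : Fin (2 * k), (0 : ℝ) ≤ (fun _ _ => 1 / 3 : Fin (2 * k) → Fin (2 * k) → ℝ) i j :=
    fun _ _ => by norm_num
  have t1 : ∀ i j : Fin (2 * k), (fun _ _ => 1 / 3 : Fin (2 * k) → Fin (2 * k) → ℝ) i j ≤ 1 :=
    fun _ _ => by norm_num
  have hpow : (11520000 * (k : ℝ)) ^ k = 9 ^ k * ((800 ^ 2) ^ k * (2 * k) ^ k) := by
    rw [← mul_pow, ← mul_pow]
    congr 1
    ring
  have hmoment : ∫ ω, ‖centeredAdj P ω‖ ^ (2 * k) ∂(bernProd P) ≤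
      n * (2 * k) * (11520000 * k) ^ k := by
    calc ∫ ω, ‖centeredAdj P ω‖ ^ (2 * k) ∂(bernProd P)
        ≤ ∫ ω, ((centeredAdj P ω) ^ (2 * k)).trace ∂(bernProd P) :=
          integral_mono (integrable_bernProd h0 h1 _) (integrable_bernProd h0 h1 _) fun ω => by
            rw [hk]
            exact (isSymm_centeredAdj P ω).norm_pow_le_trace _
      _ ≤ n * (9 ^ k * ∫ ω, ((centeredAdj (n := 2 * k) (fun _ _ => 1 / 3) ω) ^ (2 * k)).trace
          ∂(bernProd fun _ _ => 1 / 3)) :=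
          integral_trace_pow_le_third h0 hp hp0 hp1 (by push_cast; linarith) (by omega)
      _ ≤ n * (9 ^ k * ∫ ω, ((2 * k : ℕ) : ℝ) *
          ‖centeredAdj (n := 2 * k) (fun _ _ => 1 / 3) ω‖ ^ (2 * k)
          ∂(bernProd fun _ _ => 1 / 3)) := by
          refine mul_le_mul_of_nonneg_left (mul_le_mul_of_nonneg_left (integral_mono
            (integrable_bernProd t0 t1 _) (integrable_bernProd t0 t1 _) fun ω => ?_)
            (by positivity)) (Nat.cast_nonneg _)
          have := (isSymm_centeredAdj (n := 2 * k) (fun _ _ => 1 / 3) ω).trace_le_norm_pow (a + 1)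
          rwa [← hk] at this
      _ ≤ n * (9 ^ k * (((2 * k : ℕ) : ℝ) *
          (800 ^ (2 * k) * √((2 * k : ℕ) : ℝ) ^ (2 * k)))) := by
          rw [integral_const_mul]
          gcongr
          exact integral_norm_pow_le (by norm_num) (by norm_num) (by omega)
      _ = n * (2 * k) * (11520000 * k) ^ k := by
          rw [pow_mul, pow_mul, Real.sq_sqrt (Nat.cast_nonneg _)]
          rw [hpow, Nat.cast_mul, Nat.cast_ofNat]
          simp only [mul_assoc, mul_left_comm]
  set T := 38400 * √(n * p) with hT
  have hTpos : 0 < T := by positivity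
  have hmarkov := mul_meas_ge_le_integral_of_nonneg (μ := bernProd P)
    (f := fun ω => ‖centeredAdj P ω‖ ^ (2 * k))
    (Filter.Eventually.of_forall fun ω => by positivity) (integrable_bernProd h0 h1 _)
    (T ^ (2 * k))
  have hsub : (bernProd P).real {ω | T ≤ ‖centeredAdj P ω‖} ≤
      (bernProd P).real {ω | T ^ (2 * k) ≤ ‖centeredAdj P ω‖ ^ (2 * k)} :=
    measureReal_mono fun ω hω => pow_le_pow_left₀ hTpos.le hω _
  have hT2 : T ^ (2 * k) = (38400 ^ 2 * (n * p)) ^ k := by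
    rw [pow_mul, hT, mul_pow, Real.sq_sqrt (by positivity)]
  have hTlow : 64 ^ k * (11520000 * (k : ℝ)) ^ k ≤ T ^ (2 * k) := by
    rw [hT2, ← mul_pow]
    exact pow_le_pow_left₀ (by positivity) (by linarith) k
  have h2k : (2 * k : ℝ) ≤ 4 ^ k := by
    have h : k < 2 ^ k := Nat.lt_two_pow_self
    have h' : (k : ℝ) ≤ 2 ^ k := by exact_mod_cast h.le
    have h'' : (2 : ℝ) ≤ 2 ^ k := le_self_pow₀ (by norm_num) hk0.ne'
    calc (2 * k : ℝ) ≤ 2 ^ k * 2 ^ k := by gcongr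
      _ = 4 ^ k := by rw [← mul_pow]; norm_num
  have hn16 : (n : ℝ) ^ 2 ≤ 16 ^ k := by
    have he : Real.exp 1 ≤ 4 := by linarith [Real.exp_one_lt_d9]
    have : (n : ℝ) ≤ 4 ^ k := by
      rw [← Real.exp_log hn0]
      calc Real.exp (Real.log n) ≤ Real.exp (k * 1) :=
            Real.exp_le_exp.2 (by linarith)
        _ = Real.exp 1 ^ k := Real.exp_nat_mul _ _
        _ ≤ 4 ^ k := by gcongr
    calc (n : ℝ) ^ 2 ≤ (4 ^ k) ^ 2 := by gcongr
      _ = 16 ^ k := by rw [← pow_mul, mul_comm, pow_mul]; norm_num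
  refine hsub.trans ?_
  set x := (bernProd P).real {ω | T ^ (2 * k) ≤ ‖centeredAdj P ω‖ ^ (2 * k)} with hx
  have hx0 : 0 ≤ x := measureReal_nonneg
  have hQ : 0 < (11520000 * (k : ℝ)) ^ k := by positivity
  have h64 : (64 : ℝ) ^ k = 16 ^ k * 4 ^ k := by rw [← mul_pow]; norm_num
  have hfin : 64 ^ k * x ≤ n * (2 * k) := by
    refine le_of_mul_le_mul_right ?_ hQ
    calc 64 ^ k * x * (11520000 * (k : ℝ)) ^ k = 64 ^ k * (11520000 * (k : ℝ)) ^ k * x := by ring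
      _ ≤ T ^ (2 * k) * x := by gcongr
      _ ≤ _ := hmarkov.trans hmoment
  have : n ^ 2 * x ≤ n := by
    have h4 : (0 : ℝ) < 4 ^ k := by positivity
    refine le_of_mul_le_mul_right ?_ h4
    calc n ^ 2 * x * 4 ^ k ≤ 16 ^ k * x * 4 ^ k := by gcongr
      _ = 64 ^ k * x := by rw [h64]; ring
      _ ≤ n * (2 * k) := hfin
      _ ≤ n * 4 ^ k := by gcongr
  rw [le_div_iff₀ hn0]
  refine le_of_mul_le_mul_left ?_ hn0
  linarith [this]

lemma integral_exp_mul_rowSum_le {n : ℕ} {P : Fin n → Fin n → ℝ} {p : ℝ}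
    (h0 : ∀ i j, 0 ≤ P i j) (hp : ∀ i j, P i j ≤ p) (hp1 : p ≤ 1) (v : Fin n) {c : ℝ}
    (hc : |c| ≤ 1) :
    ∫ ω, Real.exp (c * ∑ j, centeredAdj P ω v j) ∂(bernProd P) ≤
      Real.exp (2 * (n * p * c ^ 2)) := by
  have hp0 : 0 ≤ p := (h0 v v).trans (hp v v)
  have h1 : ∀ i j, P i j ≤ 1 := fun i j => (hp i j).trans hp1
  have h := integral_exp_sum_le h0 h1 (fun i _ => if i = v then c else 0)
    (fun i j => (if i = v then p * c ^ 2 else 0) + if j = v then p * c ^ 2 else 0) ?_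
  · have hsum (ω : Fin n → Fin n → Bool) :
        ∑ i, ∑ j, (if i = v then c else 0) * centeredAdj P ω i j =
          c * ∑ j, centeredAdj P ω v j := by
      simp_rw [← Finset.mul_sum]
      simp
    simp only [hsum] at h
    refine h.trans (Real.exp_le_exp.2 ?_)
    calc _ ≤ ∑ i : Fin n, ∑ j : Fin n,
          ((if i = v then p * c ^ 2 else 0) + if j = v then p * c ^ 2 else 0) := by
          refine Finset.sum_le_sum fun i _ => Finset.sum_le_sum fun j _ => ?_
          have : 0 ≤ p * c ^ 2 := by positivity
          split_ifs <;> linarith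
      _ = 2 * (n * p * c ^ 2) := by
          simp [Finset.sum_add_distrib]
          ring
  · intro i j hij
    have hP : Real.exp (P i j * c ^ 2) ≤ Real.exp (p * c ^ 2) :=
      Real.exp_le_exp.2 (mul_le_mul_of_nonneg_right (hp i j) (sq_nonneg c))
    have hm := (bern_mgf_le_exp_mul (h0 i j) (h1 i j) hc).trans hP
    by_cases hi : i = v
    · have hj : j ≠ v := fun hj => hij.ne (hi.trans hj.symm)
      simpa [hi, hj] using hm
    · by_cases hj : j = v
      · simpa [hi, hj] using hm
      · simp [hi, hj]

lemma measureReal_mul_rowSum_ge_le {n : ℕ} {P : Fin n → Fin n → ℝ} {p : ℝ}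
    (h0 : ∀ i j, 0 ≤ P i j) (hp : ∀ i j, P i j ≤ p) (hp1 : p ≤ 1) (hn : 1 ≤ n)
    (hnp : 0 < n * p) (hlog : Real.log n ≤ n * p) (v : Fin n) {σ : ℝ} (hσ : |σ| = 1) :
    (bernProd P).real {ω | 5 * √(n * p * Real.log n) ≤ σ * ∑ j, centeredAdj P ω v j} ≤
      1 / n ^ 3 := by
  have h1 : ∀ i j, P i j ≤ 1 := fun i j => (hp i j).trans hp1
  have hn0 : (0 : ℝ) < n := by exact_mod_cast hn
  have := isProbabilityMeasure_bernProd h0 h1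
  have hL : 0 ≤ Real.log n := Real.log_nonneg (by exact_mod_cast hn)
  obtain ⟨l, hl⟩ : ∃ l, l = √(Real.log n / (n * p)) := ⟨_, rfl⟩
  have hl0 : 0 ≤ l := hl ▸ Real.sqrt_nonneg _
  have hl1 : l ≤ 1 := by
    rw [hl, Real.sqrt_le_one]
    exact (div_le_one hnp).2 hlog
  have hlsq : n * p * l ^ 2 = Real.log n := by
    rw [hl, Real.sq_sqrt (by positivity), mul_div_cancel₀ _ hnp.ne']
  have hlt : l * √(n * p * Real.log n) = Real.log n := by
    rw [hl, ← Real.sqrt_mul (by positivity), ← mul_assoc, div_mul_cancel₀ _ hnp.ne']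
    exact Real.sqrt_mul_self hL
  have hc : |σ * l| ≤ 1 := by rw [abs_mul, hσ, one_mul, abs_of_nonneg hl0]; exact hl1
  have hσ2 : σ ^ 2 = 1 := by rw [← sq_abs, hσ, one_pow]
  have hint := integral_exp_mul_rowSum_le h0 hp hp1 v hc
  rw [mul_pow, hσ2, one_mul, hlsq] at hint
  have hmarkov := mul_meas_ge_le_integral_of_nonneg (μ := bernProd P)
    (f := fun ω => Real.exp (σ * l * ∑ j, centeredAdj P ω v j))
    (Filter.Eventually.of_forall fun ω => (Real.exp_pos _).le) (integrable_bernProd h0 h1 _)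
    (Real.exp (5 * Real.log n))
  have hsub : (bernProd P).real {ω | 5 * √(n * p * Real.log n) ≤
      σ * ∑ j, centeredAdj P ω v j} ≤ (bernProd P).real {ω | Real.exp (5 * Real.log n) ≤
      Real.exp (σ * l * ∑ j, centeredAdj P ω v j)} := by
    refine measureReal_mono fun ω hω => Real.exp_le_exp.2 ?_
    calc 5 * Real.log n = l * (5 * √(n * p * Real.log n)) := by linear_combination -5 * hlt
      _ ≤ l * (σ * ∑ j, centeredAdj P ω v j) := mul_le_mul_of_nonneg_left hω hl0
      _ = _ := by ring
  refine hsub.trans ?_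
  have hexp (m : ℕ) : Real.exp (m * Real.log n) = n ^ m := by
    rw [Real.exp_nat_mul, Real.exp_log hn0]
  have h := hmarkov.trans hint
  rw [show (5 : ℝ) = (5 : ℕ) by norm_num, show (2 : ℝ) = (2 : ℕ) by norm_num, hexp, hexp] at h
  rw [le_div_iff₀ (by positivity)]
  refine le_of_mul_le_mul_left ?_ (pow_pos hn0 2)
  refine le_trans (le_of_eq ?_) (h.trans (le_of_eq (mul_one _).symm))
  rw [show (5 : ℝ) = (5 : ℕ) by norm_num, hexp]
  ring

/-- With high probability all row sums of a centered adjacency matrix are small. -/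
lemma measureReal_exists_abs_rowSum_ge_le {n : ℕ} {P : Fin n → Fin n → ℝ} {p : ℝ}
    (h0 : ∀ i j, 0 ≤ P i j) (hp : ∀ i j, P i j ≤ p) (hp1 : p ≤ 1) (hn : 1 ≤ n)
    (hnp : 0 < n * p) (hlog : Real.log n ≤ n * p) :
    (bernProd P).real {ω | ∃ v, 5 * √(n * p * Real.log n) ≤ |∑ j, centeredAdj P ω v j|} ≤
      2 / n ^ 2 := by
  have h1 : ∀ i j, P i j ≤ 1 := fun i j => (hp i j).trans hp1
  have hn0 : (0 : ℝ) < n := by exact_mod_cast hn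
  have := isProbabilityMeasure_bernProd h0 h1
  set t := 5 * √(n * p * Real.log n)
  calc _ ≤ (bernProd P).real (⋃ v, ({ω | t ≤ 1 * ∑ j, centeredAdj P ω v j} ∪
        {ω | t ≤ -1 * ∑ j, centeredAdj P ω v j})) := by
        refine measureReal_mono ?_
        rintro ω ⟨v, hv⟩
        refine Set.mem_iUnion.2 ⟨v, ?_⟩
        rcases le_abs.1 hv with h | h
        · exact Or.inl (by simpa using h)
        · exact Or.inr (by simpa using h)
    _ ≤ ∑ v : Fin n, (bernProd P).real ({ω | t ≤ 1 * ∑ j, centeredAdj P ω v j} ∪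
        {ω | t ≤ -1 * ∑ j, centeredAdj P ω v j}) := measureReal_iUnion_fintype_le _
    _ ≤ ∑ v : Fin n, (1 / (n : ℝ) ^ 3 + 1 / n ^ 3) := by
        refine Finset.sum_le_sum fun v _ => (measureReal_union_le _ _).trans (add_le_add ?_ ?_)
        · exact measureReal_mul_rowSum_ge_le h0 hp hp1 hn hnp hlog v (by simp)
        · exact measureReal_mul_rowSum_ge_le h0 hp hp1 hn hnp hlog v (by simp)
    _ = 2 / n ^ 2 := by
        simp only [Finset.sum_const, Finset.card_univ, Fintype.card_fin, nsmul_eq_mul]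
        field_simp
        ring

lemma Matrix.abs_sum_sum_le_l2_opNorm {n : ℕ} (M : Matrix (Fin n) (Fin n) ℝ) :
    |∑ i, ∑ j, M i j| ≤ n * ‖M‖ := by
  have hx : ‖(WithLp.toLp 2 1 : EuclideanSpace ℝ (Fin n))‖ ^ 2 = n := by
    rw [EuclideanSpace.real_norm_sq_eq]
    simp
  have hform : inner ℝ (WithLp.toLp 2 1 : EuclideanSpace ℝ (Fin n))
      (Matrix.toEuclideanCLM (𝕜 := ℝ) M (WithLp.toLp 2 1)) = ∑ i, ∑ j, M i j := by
    rw [Matrix.inner_toEuclideanCLM]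
    simp [dotProduct, Matrix.mulVec]
  rw [← hform, ← hx]
  calc _ ≤ _ := abs_real_inner_le_norm _ _
    _ ≤ ‖(WithLp.toLp 2 1 : EuclideanSpace ℝ (Fin n))‖ *
        (‖M‖ * ‖(WithLp.toLp 2 1 : EuclideanSpace ℝ (Fin n))‖) := by
        gcongr
        exact (Matrix.toEuclideanCLM (𝕜 := ℝ) M).le_opNorm _
    _ = _ := by ring

lemma Matrix.l2_opNorm_le_of_entry_le {n : ℕ} (M : Matrix (Fin n) (Fin n) ℝ)
    {c : ℝ} (hc : 0 ≤ c) (h : ∀ i j, |M i j| ≤ c) : ‖M‖ ≤ n * c := by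
  refine le_of_sq_le_sq ((Matrix.l2_opNorm_sq_le_sum_sq M).trans ?_) (by positivity)
  calc ∑ i, ∑ j, M i j ^ 2 ≤ ∑ i : Fin n, ∑ j : Fin n, c ^ 2 :=
        Finset.sum_le_sum fun i _ => Finset.sum_le_sum fun j _ => sq_le_sq.2 (by
          rw [abs_of_nonneg hc]; exact h i j)
    _ = (n * c) ^ 2 := by simp; ring

lemma Matrix.l2_opNorm_diagonal_conj_sub_le {n : ℕ} (M : Matrix (Fin n) (Fin n) ℝ)
    {f : Fin n → ℝ} {ε B : ℝ} (hε : 0 ≤ ε) (hB : 0 ≤ B) (hf : ∀ i, |f i - 1| ≤ ε)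
    (hfB : ∀ i, |f i| ≤ B) :
    ‖Matrix.diagonal f * M * Matrix.diagonal f - M‖ ≤ ε * ‖M‖ * (B + 1) := by
  have h1 : ‖Matrix.diagonal f - 1‖ ≤ ε := by
    rw [← Matrix.diagonal_one, Matrix.diagonal_sub, Matrix.l2_opNorm_diagonal]
    exact (pi_norm_le_iff_of_nonneg hε).2 hf
  have h2 : ‖Matrix.diagonal f‖ ≤ B := by
    rw [Matrix.l2_opNorm_diagonal]
    exact (pi_norm_le_iff_of_nonneg hB).2 hfB
  calc _ = ‖(Matrix.diagonal f - 1) * M * Matrix.diagonal f + M * (Matrix.diagonal f - 1)‖ := by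
        congr 1
        noncomm_ring
    _ ≤ ‖Matrix.diagonal f - 1‖ * ‖M‖ * ‖Matrix.diagonal f‖ + ‖M‖ * ‖Matrix.diagonal f - 1‖ :=
        (norm_add_le _ _).trans (add_le_add ((norm_mul_le _ _).trans (mul_le_mul_of_nonneg_right
          (norm_mul_le _ _) (norm_nonneg _))) (norm_mul_le _ _))
    _ ≤ ε * ‖M‖ * B + ‖M‖ * ε := by gcongr
    _ = _ := by ring

lemma adjM_apply_of_symm {n : ℕ} {P : Fin n → Fin n → ℝ} (hP : ∀ i j, P i j = P j i)
    (ω : Fin n → Fin n → Bool) (i j : Fin n) :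
    adjM ω i j = centeredAdj P ω i j + if i = j then 0 else P i j := by
  rcases lt_trichotomy i j with h | h | h
  · simp [adjM, centeredAdj, h.le, h.ne]
  · simp [adjM, centeredAdj, h]
  · simp [adjM, centeredAdj, h.le, h.ne', h.not_ge, hP i j]

/-- Edge probabilities of the two-block model. -/
noncomputable def blockProb (n : ℕ) (p q : ℝ) (i j : Fin n) : ℝ :=
  if ((i : ℕ) < n / 2 ↔ (j : ℕ) < n / 2) then p else q

/-- The unit-normalized expected adjacency matrix `(1/n)𝟙𝟙ᵀ + γ ssᵀ`. -/
noncomputable def signalMat (n : ℕ) (γ : ℝ) : Matrix (Fin n) (Fin n) ℝ :=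
  (n : ℝ)⁻¹ • Matrix.of (fun _ _ => (1 : ℝ)) + γ • Matrix.vecMulVec (sig n) (sig n)

lemma sig_mul_sig {n : ℕ} (i j : Fin n) :
    sig n i * sig n j = if ((i : ℕ) < n / 2 ↔ (j : ℕ) < n / 2) then (n : ℝ)⁻¹ else -(n : ℝ)⁻¹ := by
  have h : (√(n : ℝ))⁻¹ * (√(n : ℝ))⁻¹ = (n : ℝ)⁻¹ := by
    rw [← mul_inv, Real.mul_self_sqrt (Nat.cast_nonneg n)]
  unfold sig
  by_cases h1 : (i : ℕ) < n / 2 <;> by_cases h2 : (j : ℕ) < n / 2 <;> simp [h1, h2, h]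

lemma sum_sig {n : ℕ} (hn : Even n) : ∑ i, sig n i = 0 := by
  obtain ⟨m, rfl⟩ := hn
  have h : (m + m) / 2 = m := by omega
  rw [Fin.sum_univ_add]
  simp [sig, h]

lemma adjM_eq {n : ℕ} {p q : ℝ} (hn : 0 < n) (hpq : p + q ≠ 0) (ω : Fin n → Fin n → Bool) :
    adjM ω = centeredAdj (blockProb n p q) ω - p • (1 : Matrix (Fin n) (Fin n) ℝ) +
      (n * (p + q) / 2) • signalMat n ((p - q) / (p + q)) := by
  have hn0 : (n : ℝ) ≠ 0 := by exact_mod_cast hn.ne'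
  have hs : ∀ i j, blockProb n p q i j = blockProb n p q j i :=
    fun i j => if_congr iff_comm rfl rfl
  ext i j
  rw [adjM_apply_of_symm hs]
  simp only [signalMat, Matrix.add_apply, Matrix.sub_apply, Matrix.smul_apply, Matrix.of_apply,
    Matrix.vecMulVec_apply, sig_mul_sig, smul_eq_mul, Matrix.one_apply, blockProb]
  by_cases h : i = j
  · subst h
    simp only [if_true]
    field_simp
    ring
  · simp only [h, if_false]
    split_ifs
    · field_simp
      ring
    · field_simp
      ring

lemma norm_const_inv_le_one {n : ℕ} (hn : 0 < n) :
    ‖(n : ℝ)⁻¹ • (Matrix.of (fun _ _ => (1 : ℝ)) : Matrix (Fin n) (Fin n) ℝ)‖ ≤ 1 := by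
  have hn0 : (0 : ℝ) < n := by exact_mod_cast hn
  refine (Matrix.l2_opNorm_le_of_entry_le _ (c := (n : ℝ)⁻¹) (by positivity) fun i j => ?_).trans
    (mul_inv_cancel₀ hn0.ne').le
  simp [abs_of_pos hn0]

lemma norm_signalMat_le_two {n : ℕ} (hn : 0 < n) {γ : ℝ} (hγ : |γ| ≤ 1) :
    ‖signalMat n γ‖ ≤ 2 := by
  have hn0 : (0 : ℝ) < n := by exact_mod_cast hn
  have hS : ‖Matrix.vecMulVec (sig n) (sig n)‖ ≤ 1 := by
    refine (Matrix.l2_opNorm_le_of_entry_le _ (c := (n : ℝ)⁻¹) (by positivity) fun i j => ?_).trans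
      (mul_inv_cancel₀ hn0.ne').le
    rw [Matrix.vecMulVec_apply, sig_mul_sig]
    split_ifs <;> simp [abs_of_pos hn0]
  calc _ ≤ _ := norm_add_le _ _
    _ ≤ 1 + 1 * 1 := by
        rw [norm_smul γ]
        exact add_le_add (norm_const_inv_le_one hn)
          (mul_le_mul hγ hS (norm_nonneg _) zero_le_one)
    _ = 2 := by norm_num

lemma sum_signalMat {n : ℕ} (hn : 0 < n) (hev : Even n) (γ : ℝ) (i : Fin n) :
    ∑ j, signalMat n γ i j = 1 := by
  have hn0 : (n : ℝ) ≠ 0 := by exact_mod_cast hn.ne'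
  simp only [signalMat, Matrix.add_apply, Matrix.smul_apply, Matrix.of_apply,
    Matrix.vecMulVec_apply, smul_eq_mul, Finset.sum_add_distrib, ← Finset.mul_sum, sum_sig hev]
  simp [hn0]

lemma degv_eq {n : ℕ} {p q : ℝ} (hn : 0 < n) (hev : Even n) (hpq : p + q ≠ 0)
    (ω : Fin n → Fin n → Bool) (v : Fin n) :
    degv ω v = ∑ j, centeredAdj (blockProb n p q) ω v j - p + n * (p + q) / 2 := by
  unfold degv
  rw [adjM_eq (q := q) hn hpq]
  simp only [Matrix.add_apply, Matrix.sub_apply, Matrix.smul_apply, smul_eq_mul,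
    Finset.sum_add_distrib, Finset.sum_sub_distrib, ← Finset.mul_sum, sum_signalMat hn hev]
  simp [Matrix.one_apply]

lemma sum_degv {n : ℕ} (hn : 0 < n) (ω : Fin n → Fin n → Bool) :
    ∑ v, degv ω v = n * avgDeg ω := by
  have hn0 : (n : ℝ) ≠ 0 := by exact_mod_cast hn.ne'
  unfold degv avgDeg
  field_simp

lemma abs_avgDeg_sub_le {n : ℕ} {p q : ℝ} (hn : 0 < n) (hev : Even n) (hp : 0 ≤ p)
    (hpq : p + q ≠ 0) (ω : Fin n → Fin n → Bool) :
    |avgDeg ω - n * (p + q) / 2| ≤ ‖centeredAdj (blockProb n p q) ω‖ + p := by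
  have hn0 : (0 : ℝ) < n := by exact_mod_cast hn
  have h := sum_degv hn ω
  simp only [degv_eq (q := q) hn hev hpq, Finset.sum_add_distrib, Finset.sum_sub_distrib,
    Finset.sum_const, Finset.card_univ, Fintype.card_fin, nsmul_eq_mul] at h
  have h2 := abs_le.1 (Matrix.abs_sum_sum_le_l2_opNorm (centeredAdj (blockProb n p q) ω))
  rw [abs_le]
  constructor
  · refine le_of_mul_le_mul_left ?_ hn0
    nlinarith
  · refine le_of_mul_le_mul_left ?_ hn0
    nlinarith

lemma tildeA_sub_eq {n : ℕ} {p q : ℝ} (hn : 0 < n) (hpq : p + q ≠ 0)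
    (ω : Fin n → Fin n → Bool) :
    tildeA ω - ((p - q) / (p + q)) • Matrix.vecMulVec (sig n) (sig n) =
      (avgDeg ω)⁻¹ • (centeredAdj (blockProb n p q) ω - p • (1 : Matrix (Fin n) (Fin n) ℝ)) +
      ((avgDeg ω)⁻¹ * (n * (p + q) / 2) - 1) • signalMat n ((p - q) / (p + q)) := by
  unfold tildeA
  rw [adjM_eq (q := q) hn hpq, sub_smul, one_smul, smul_add, smul_smul]
  nth_rw 3 [signalMat]
  abel

/-- The normalized matrix, expressed through conjugation by square roots of the relative
degrees. -/
lemma hatA_eq {n : ℕ} (hn : 0 < n) {ω : Fin n → Fin n → Bool} (hd : 0 < avgDeg ω)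
    {f g : Fin n → ℝ} (hf : ∀ v, f v = √(degv ω v) / √(avgDeg ω))
    (hg : ∀ v, g v = √(avgDeg ω) / √(degv ω v)) :
    hatA ω = Matrix.diagonal g * ((avgDeg ω)⁻¹ • adjM ω) * Matrix.diagonal g -
      Matrix.diagonal f * ((n : ℝ)⁻¹ • Matrix.of (fun _ _ => (1 : ℝ))) * Matrix.diagonal f := by
  have hn0 : (n : ℝ) ≠ 0 := by exact_mod_cast hn.ne'
  have hss : √(avgDeg ω) * √(avgDeg ω) = avgDeg ω := Real.mul_self_sqrt hd.le
  have hs : √(avgDeg ω) ≠ 0 := (Real.sqrt_pos.2 hd).ne'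
  ext i j
  simp only [hatA, Matrix.sub_apply, Matrix.of_apply, Matrix.mul_diagonal, Matrix.diagonal_mul,
    Matrix.smul_apply, smul_eq_mul, hf, hg, sum_degv hn]
  generalize √(avgDeg ω) = s at hss hs
  rw [← hss]
  congr 1
  · simp only [div_eq_mul_inv, mul_inv]
    field_simp
  · field_simp

lemma norm_tildeA_sub_le {n : ℕ} {p q K X : ℝ} (hn : 0 < n) (hev : Even n) (hp : 0 < p)
    (hq : 0 ≤ q) (hqp : q < p) (hp1 : p ≤ 1) (hX : X ^ 2 = n * p) (hK : 1 ≤ K)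
    (hKX : 16 * K ≤ X) {ω : Fin n → Fin n → Bool}
    (hW : ‖centeredAdj (blockProb n p q) ω‖ ≤ K * X) :
    X ^ 2 / 4 ≤ avgDeg ω ∧ |avgDeg ω - n * (p + q) / 2| ≤ 2 * K * X ∧
    ‖tildeA ω - ((p - q) / (p + q)) • Matrix.vecMulVec (sig n) (sig n)‖ ≤ 24 * K / X := by
  have hn0 : (0 : ℝ) < n := by exact_mod_cast hn
  have hpq : 0 < p + q := by linarith
  have hX1 : 1 ≤ X := by linarith
  have hKX1 : 1 ≤ K * X := one_le_mul_of_one_le_of_one_le hK hX1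
  have hda := (abs_avgDeg_sub_le hn hev hp.le hpq.ne' ω).trans
    (show _ ≤ 2 * K * X by linarith)
  have hnq : 0 ≤ n * q := by positivity
  have hd : X ^ 2 / 4 ≤ avgDeg ω := by
    have := (abs_le.1 hda).1
    nlinarith
  have hd0 : 0 < avgDeg ω := lt_of_lt_of_le (by positivity) hd
  refine ⟨hd, hda, ?_⟩
  have hγ : |(p - q) / (p + q)| ≤ 1 := by
    rw [abs_div, abs_of_pos hpq, abs_of_pos (by linarith), div_le_one hpq]
    linarith
  have hone : ‖p • (1 : Matrix (Fin n) (Fin n) ℝ)‖ ≤ 1 := by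
    rw [norm_smul, Real.norm_of_nonneg hp.le, ← Matrix.diagonal_one, Matrix.l2_opNorm_diagonal]
    refine mul_le_one₀ hp1 (norm_nonneg _) ((pi_norm_le_iff_of_nonneg zero_le_one).2 fun i => ?_)
    simp
  have hinv : (avgDeg ω)⁻¹ ≤ 4 / X ^ 2 := by
    rw [show 4 / X ^ 2 = (X ^ 2 / 4)⁻¹ by rw [inv_div]]
    exact inv_anti₀ (by positivity) hd
  have hcoef : |(avgDeg ω)⁻¹ * (n * (p + q) / 2) - 1| ≤ (avgDeg ω)⁻¹ * (2 * K * X) := by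
    rw [show (avgDeg ω)⁻¹ * (n * (p + q) / 2) - 1 =
      (avgDeg ω)⁻¹ * (n * (p + q) / 2 - avgDeg ω) by field_simp, abs_mul,
      abs_of_pos (inv_pos.2 hd0), abs_sub_comm]
    gcongr
  rw [tildeA_sub_eq hn hpq.ne']
  calc _ ≤ ‖(avgDeg ω)⁻¹ • (centeredAdj (blockProb n p q) ω -
          p • (1 : Matrix (Fin n) (Fin n) ℝ))‖ +
        ‖((avgDeg ω)⁻¹ * (n * (p + q) / 2) - 1) • signalMat n ((p - q) / (p + q))‖ :=
        norm_add_le _ _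
    _ ≤ (avgDeg ω)⁻¹ * (K * X + 1) + (avgDeg ω)⁻¹ * (2 * K * X) * 2 := by
        rw [norm_smul, norm_smul, Real.norm_of_nonneg (inv_pos.2 hd0).le, Real.norm_eq_abs]
        gcongr
        · exact (norm_sub_le _ _).trans (add_le_add hW hone)
        · exact norm_signalMat_le_two hn hγ
    _ = (avgDeg ω)⁻¹ * (5 * (K * X) + 1) := by ring
    _ ≤ 4 / X ^ 2 * (6 * (K * X)) := by
        gcongr
        linarith
    _ = 24 * K / X := by
        field_simp
        norm_num

lemma norm_hatA_sub_le {n : ℕ} {p q K X l : ℝ} (hn : 0 < n) (hev : Even n) (hp : 0 < p)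
    (hq : 0 ≤ q) (hqp : q < p) (hp1 : p ≤ 1) (hX : X ^ 2 = n * p) (hK : 1 ≤ K) (hl : 1 ≤ l)
    (hKX : 64 * K * l ≤ X) {ω : Fin n → Fin n → Bool}
    (hW : ‖centeredAdj (blockProb n p q) ω‖ ≤ K * X)
    (hrow : ∀ v, |∑ j, centeredAdj (blockProb n p q) ω v j| ≤ 5 * (X * l)) :
    ‖hatA ω - ((p - q) / (p + q)) • Matrix.vecMulVec (sig n) (sig n)‖ ≤ 1000 * K * (l / X) := by
  have hpq : 0 < p + q := by linarith
  have hKl : K ≤ K * l := le_mul_of_one_le_right (by linarith) hl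
  have hX0 : 0 < X := by linarith
  obtain ⟨hd, hda, hT⟩ := norm_tildeA_sub_le hn hev hp hq hqp hp1 hX hK (by linarith) hW
  have hd0 : 0 < avgDeg ω := lt_of_lt_of_le (by positivity) hd
  obtain ⟨δ, hδ⟩ : ∃ δ, δ = 32 * K * (l / X) := ⟨_, rfl⟩
  have hδ0 : 0 ≤ δ := by rw [hδ]; positivity
  have hδ1 : δ ≤ 1 / 2 := by
    rw [hδ, ← mul_div_assoc, div_le_iff₀ hX0]
    linarith
  have hdeg (v : Fin n) : |degv ω v / avgDeg ω - 1| ≤ δ := by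
    rw [show degv ω v / avgDeg ω - 1 = (degv ω v - avgDeg ω) / avgDeg ω by field_simp, abs_div,
      abs_of_pos hd0, div_le_iff₀ hd0]
    have hXl : X ≤ X * l := le_mul_of_one_le_right hX0.le hl
    have hXl' : X * l ≤ K * (X * l) := le_mul_of_one_le_left (by positivity) hK
    have hKXl : K * X ≤ K * (X * l) := mul_le_mul_of_nonneg_left hXl (by linarith)
    calc |degv ω v - avgDeg ω| ≤ 8 * (K * (X * l)) := by
          have h1 := abs_le.1 (hrow v)
          have h2 := abs_le.1 hda
          rw [degv_eq (q := q) hn hev hpq.ne', abs_le]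
          constructor <;> linarith
      _ = δ * (X ^ 2 / 4) := by
          rw [hδ]
          field_simp
          norm_num
      _ ≤ δ * avgDeg ω := by gcongr
  obtain ⟨f, hf⟩ : ∃ f : Fin n → ℝ, ∀ v, f v = √(degv ω v) / √(avgDeg ω) :=
    ⟨fun v => √(degv ω v) / √(avgDeg ω), fun v => rfl⟩
  obtain ⟨g, hg⟩ : ∃ g : Fin n → ℝ, ∀ v, g v = √(avgDeg ω) / √(degv ω v) :=
    ⟨fun v => √(avgDeg ω) / √(degv ω v), fun v => rfl⟩
  have hf0 (v : Fin n) : 0 ≤ f v := by rw [hf]; positivity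
  have hfsq (v : Fin n) : f v ^ 2 = degv ω v / avgDeg ω := by
    have h := (abs_le.1 (hdeg v)).1
    have h' : 0 ≤ degv ω v / avgDeg ω := by linarith
    rw [hf, ← Real.sqrt_div' _ hd0.le, Real.sq_sqrt h']
  have hf1 (v : Fin n) : |f v - 1| ≤ δ := by
    refine le_trans ?_ (hdeg v)
    rw [← hfsq, show f v ^ 2 - 1 = (f v - 1) * (f v + 1) by ring, abs_mul]
    refine le_mul_of_one_le_right (abs_nonneg _) ?_
    rw [abs_of_nonneg (by linarith [hf0 v])]
    linarith [hf0 v]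
  have hf2 (v : Fin n) : 1 / 2 ≤ f v := by linarith [(abs_le.1 (hf1 v)).1]
  have hgf (v : Fin n) : g v = (f v)⁻¹ := by rw [hg, hf, inv_div]
  have hg2 (v : Fin n) : |g v| ≤ 2 := by
    rw [hgf, abs_of_nonneg (inv_nonneg.2 (hf0 v)), show (2 : ℝ) = (1 / 2)⁻¹ by norm_num]
    exact inv_anti₀ (by norm_num) (hf2 v)
  have hg1 (v : Fin n) : |g v - 1| ≤ 2 * δ := by
    have hv : f v ≠ 0 := by linarith [hf2 v]
    rw [show g v - 1 = g v * (1 - f v) by rw [hgf]; field_simp, abs_mul, abs_sub_comm 1]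
    exact mul_le_mul (hg2 v) (hf1 v) (abs_nonneg _) zero_le_two
  have hf3 (v : Fin n) : |f v| ≤ 2 := by
    rw [abs_of_nonneg (hf0 v)]
    linarith [(abs_le.1 (hf1 v)).2]
  have hγ : |(p - q) / (p + q)| ≤ 1 := by
    rw [abs_div, abs_of_pos hpq, abs_of_pos (by linarith), div_le_one hpq]
    linarith
  have hM : ‖(avgDeg ω)⁻¹ • adjM ω‖ ≤ 4 := by
    have h : (avgDeg ω)⁻¹ • adjM ω = tildeA ω - ((p - q) / (p + q)) •
        Matrix.vecMulVec (sig n) (sig n) + signalMat n ((p - q) / (p + q)) := by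
      unfold tildeA signalMat
      abel
    have hKX' : 24 * K / X ≤ 2 := by
      rw [div_le_iff₀ hX0]
      linarith
    rw [h]
    linarith [norm_add_le (tildeA ω - ((p - q) / (p + q)) • Matrix.vecMulVec (sig n) (sig n))
      (signalMat n ((p - q) / (p + q))), norm_signalMat_le_two hn hγ]
  have hJ := norm_const_inv_le_one hn
  have h1 := Matrix.l2_opNorm_diagonal_conj_sub_le ((avgDeg ω)⁻¹ • adjM ω)
    (by positivity) zero_le_two hg1 hg2
  have h2 := Matrix.l2_opNorm_diagonal_conj_sub_le
    ((n : ℝ)⁻¹ • (Matrix.of (fun _ _ => (1 : ℝ)) : Matrix (Fin n) (Fin n) ℝ)) hδ0 zero_le_two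
    hf1 hf3
  have hlX : 24 * K / X ≤ 24 * K * (l / X) := by
    rw [div_eq_mul_one_div]
    gcongr
  have hsplit : hatA ω - ((p - q) / (p + q)) • Matrix.vecMulVec (sig n) (sig n) =
      (Matrix.diagonal g * ((avgDeg ω)⁻¹ • adjM ω) * Matrix.diagonal g - (avgDeg ω)⁻¹ • adjM ω) -
      (Matrix.diagonal f * ((n : ℝ)⁻¹ • Matrix.of (fun _ _ => (1 : ℝ))) * Matrix.diagonal f -
        (n : ℝ)⁻¹ • Matrix.of (fun _ _ => (1 : ℝ))) +
      (tildeA ω - ((p - q) / (p + q)) • Matrix.vecMulVec (sig n) (sig n)) := by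
    rw [hatA_eq hn hd0 hf hg]
    unfold tildeA
    abel
  rw [hsplit]
  calc _ ≤ _ := norm_add_le _ _
    _ ≤ _ := add_le_add_left (norm_sub_le _ _) _
    _ ≤ (2 * δ * 4 * (2 + 1) + δ * 1 * (2 + 1)) + 24 * K * (l / X) := by
        refine add_le_add (add_le_add (h1.trans ?_) (h2.trans ?_)) (hT.trans hlX)
        · gcongr
        · gcongr
    _ = 888 * K * (l / X) := by rw [hδ]; ring
    _ ≤ 1000 * K * (l / X) := by gcongr; norm_num

/-- In the 2-block SBM with `p ≥ Ω(log²n/n)`, `p > q` and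
`γ = (p-q)/(p+q)`, with probability `1 - n^{-Ω(1)}` both
`‖Ã - γ ssᵀ‖ ≤ O(1/√(np))` and `‖Â - γ ssᵀ‖ ≤ O(√(log n/(np)))` hold. -/
theorem corrected_convolution_concentration :
    ∃ (C₁ C₂ c : ℝ) (n₀ : ℕ), 0 < C₁ ∧ 0 < C₂ ∧ 0 < c ∧
      ∀ (n : ℕ) (p q : ℝ), n₀ ≤ n → Even n → 0 ≤ q → q < p → p ≤ 1 →
        C₁ * (Real.log n) ^ 2 / n ≤ p →
        ENNReal.ofReal (1 - (n : ℝ) ^ (-c)) ≤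
          sbm n p q
            {ω |
              specNorm (tildeA ω -
                  ((p - q) / (p + q)) • Matrix.vecMulVec (sig n) (sig n)) ≤
                C₂ / Real.sqrt (n * p) ∧
              specNorm (hatA ω -
                  ((p - q) / (p + q)) • Matrix.vecMulVec (sig n) (sig n)) ≤
                C₂ * Real.sqrt (Real.log n / (n * p))} := by
  obtain ⟨K, hK⟩ : ∃ K : ℝ, K = 38400 := ⟨_, rfl⟩
  refine ⟨(64 * K) ^ 2, 1000 * K, 1 / 2, 16, by rw [hK]; norm_num, by rw [hK]; norm_num,
    by norm_num, fun n p q hn hev hq hqp hp1 hlow => ?_⟩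
  have hK1 : 1 ≤ K := by rw [hK]; norm_num
  have hn16 : (16 : ℝ) ≤ n := by exact_mod_cast hn
  have hn0 : (0 : ℝ) < n := by linarith
  have hp : 0 < p := hq.trans_lt hqp
  have hL : 1 ≤ Real.log n := by
    rw [Real.le_log_iff_exp_le hn0]
    linarith [Real.exp_one_lt_d9]
  rw [div_le_iff₀ hn0, mul_comm p] at hlow
  have hL2 : Real.log n ≤ Real.log n ^ 2 := le_self_pow₀ hL two_ne_zero
  have hKL : (64 * K) ^ 2 * Real.log n ≤ n * p :=
    (mul_le_mul_of_nonneg_left hL2 (sq_nonneg _)).trans hlow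
  have hlog : Real.log n ≤ n * p :=
    (le_mul_of_one_le_left (by linarith) (one_le_pow₀ (by linarith))).trans hKL
  have hnp : 0 < n * p := by positivity
  have hX : √(n * p) ^ 2 = n * p := Real.sq_sqrt hnp.le
  have hl : 1 ≤ √(Real.log n) := Real.one_le_sqrt.2 hL
  have hKX : 64 * K * √(Real.log n) ≤ √(n * p) := by
    refine Real.le_sqrt_of_sq_le ?_
    rw [mul_pow, Real.sq_sqrt (by linarith)]
    exact hKL
  have h0 : ∀ i j, 0 ≤ blockProb n p q i j := fun i j => by
    unfold blockProb
    split_ifs <;> linarith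
  have hP : ∀ i j, blockProb n p q i j ≤ p := fun i j => by
    unfold blockProb
    split_ifs <;> linarith
  have hsbm : sbm n p q = bernProd (blockProb n p q) := rfl
  have := isProbabilityMeasure_bernProd h0 fun i j => (hP i j).trans hp1
  have hbad1 := measureReal_norm_centeredAdj_gt_le h0 hP hp.le hp1 (by omega) (hL.trans hlog) hlog
  have hbad2 := measureReal_exists_abs_rowSum_ge_le h0 hP hp1 (by omega) hnp hlog
  rw [← hK] at hbad1
  set B₁ := {ω | K * √(n * p) ≤ ‖centeredAdj (blockProb n p q) ω‖}
  set B₂ := {ω | ∃ v, 5 * √(n * p * Real.log n) ≤ |∑ j, centeredAdj (blockProb n p q) ω v j|}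
  have hgood : (B₁ ∪ B₂)ᶜ ⊆ {ω |
      specNorm (tildeA ω - ((p - q) / (p + q)) • Matrix.vecMulVec (sig n) (sig n)) ≤
        1000 * K / √(n * p) ∧
      specNorm (hatA ω - ((p - q) / (p + q)) • Matrix.vecMulVec (sig n) (sig n)) ≤
        1000 * K * √(Real.log n / (n * p))} := by
    intro ω hω
    have hW : ‖centeredAdj (blockProb n p q) ω‖ ≤ K * √(n * p) :=
      (not_le.1 fun h => hω (Or.inl h)).le
    have hrow (v : Fin n) : |∑ j, centeredAdj (blockProb n p q) ω v j| ≤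
        5 * (√(n * p) * √(Real.log n)) := by
      rw [← Real.sqrt_mul hnp.le]
      exact (not_le.1 fun h => hω (Or.inr ⟨v, h⟩)).le
    have hKl : K ≤ K * √(Real.log n) := le_mul_of_one_le_right (by linarith) hl
    constructor
    · refine (norm_tildeA_sub_le (by omega) hev hp hq hqp hp1 hX hK1 (by linarith) hW).2.2.trans ?_
      gcongr
      norm_num
    · rw [Real.sqrt_div' _ hnp.le]
      exact norm_hatA_sub_le (by omega) hev hp hq hqp hp1 hX hK1 hl hKX hW hrow
  have hrate : 1 / (n : ℝ) + 2 / n ^ 2 ≤ (n : ℝ) ^ (-(1 / 2) : ℝ) := by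
    have hs4 : 4 ≤ √(n : ℝ) := Real.le_sqrt_of_sq_le (by linarith)
    have hss : √(n : ℝ) * √n = n := Real.mul_self_sqrt hn0.le
    rw [Real.rpow_neg hn0.le, ← Real.sqrt_eq_rpow, ← one_div, le_div_iff₀ (by linarith),
      show 1 / (n : ℝ) + 2 / n ^ 2 = (n + 2) / n ^ 2 by field_simp, div_mul_eq_mul_div,
      div_le_one (by positivity)]
    generalize √(n : ℝ) = s at hs4 hss
    nlinarith
  have hbad : (bernProd (blockProb n p q)).real (B₁ ∪ B₂) ≤ (n : ℝ) ^ (-(1 / 2) : ℝ) :=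
    (measureReal_union_le _ _).trans ((add_le_add hbad1 hbad2).trans hrate)
  rw [hsbm]
  refine le_trans ?_ (measure_mono hgood)
  rw [← ofReal_measureReal, probReal_compl_eq_one_sub (Set.toFinite _).measurableSet]
  exact ENNReal.ofReal_le_ofReal (by linarith)

end SpectralNorm
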